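/- arXiv:math/0608135 — 2 statements merged into one kernel-verified Lean document; each statement's English description precedes it below -/
import Mathlib

section
/- Let μ > −π². Then there exists a positive minimizer w ∈ H¹₀(0,1) of the functional J[u] = (1/2)∫₀¹(u'² + μu²)dx subject to the constraint ∫₀¹ u⁴ dx = 1. -/
open Real Set intervalIntegral

/-- Membership in H¹₀(0,1), modelled by C¹ functions vanishing at the endpoints. -/
def H10 (u : ℝ → ℝ) : Prop := ContDiff ℝ 1 u ∧ u 0 = 0 ∧ u 1 = 0

open Filter Topology

lemma aux_lin3 (a b c : ℝ) (f g h : ℝ → ℝ) (hf : Continuous f) (hg : Continuous g)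
    (hh : Continuous h) (p q : ℝ) :
    ∫ x in p..q, (a * f x + b * g x + c * h x) =
      a * (∫ x in p..q, f x) + b * (∫ x in p..q, g x) + c * (∫ x in p..q, h x) := by
  rw [intervalIntegral.integral_add, intervalIntegral.integral_add,
    intervalIntegral.integral_const_mul, intervalIntegral.integral_const_mul,
    intervalIntegral.integral_const_mul]
  all_goals exact Continuous.intervalIntegrable (by fun_prop) _ _

lemma aux_nonneg (f : ℝ → ℝ) (hf : ∀ x ∈ Icc (0:ℝ) 1, 0 ≤ f x) : 0 ≤ ∫ x in (0:ℝ)..1, f x :=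
  intervalIntegral.integral_nonneg (by norm_num) hf

lemma aux_cs (u : ℝ → ℝ) (hu : Continuous u) :
    (∫ x in (0:ℝ)..1, (u x)^2)^2 ≤ ∫ x in (0:ℝ)..1, (u x)^4 := by
  set a := ∫ x in (0:ℝ)..1, (u x)^2 with ha
  have h0 : 0 ≤ ∫ x in (0:ℝ)..1, ((u x)^2 - a)^2 := aux_nonneg _ fun x _ => sq_nonneg _
  have h1 : ∫ x in (0:ℝ)..1, ((u x)^2 - a)^2 =
      1 * (∫ x in (0:ℝ)..1, (u x)^4) + (-2*a) * a + a^2 * ∫ x in (0:ℝ)..1, (1:ℝ) := by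
    conv_rhs => rw [ha]
    rw [← ha, ← aux_lin3 1 (-2*a) (a^2) (fun x => u x^4) (fun x => u x^2) (fun _ => 1)
      (by fun_prop) (by fun_prop) (by fun_prop)]
    exact intervalIntegral.integral_congr fun x _ => by ring
  rw [h1] at h0
  simp at h0
  nlinarith

lemma aux_holder (u : ℝ → ℝ) (hu : ContDiff ℝ 1 u) (x y : ℝ) (h0 : 0 ≤ x) (hxy : x ≤ y)
    (h1 : y ≤ 1) :
    (u y - u x)^2 ≤ (y - x) * ∫ t in (0:ℝ)..1, (deriv u t)^2 := by
  have hc : Continuous (deriv u) := hu.continuous_deriv (by norm_num)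
  have hd : ∫ t in x..y, deriv u t = u y - u x :=
    intervalIntegral.integral_deriv_eq_sub (fun t _ => hu.differentiable (by norm_num) t)
      (hc.intervalIntegrable _ _)
  have hle : ∫ t in x..y, (deriv u t)^2 ≤ ∫ t in (0:ℝ)..1, (deriv u t)^2 :=
    intervalIntegral.integral_mono_interval h0 hxy h1
      (Filter.Eventually.of_forall fun t => sq_nonneg _)
      (Continuous.intervalIntegrable (by fun_prop) _ _)
  rcases hxy.eq_or_lt with rfl | hlt
  · simp
  have hp : 0 < y - x := by linarith
  set d := u y - u x
  set s := d / (y - x) with hs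
  have h2 : 0 ≤ ∫ t in x..y, (deriv u t - s)^2 :=
    intervalIntegral.integral_nonneg hxy fun x _ => sq_nonneg _
  have h3 : ∫ t in x..y, (deriv u t - s)^2 =
      1 * (∫ t in x..y, (deriv u t)^2) + (-2*s) * d + s^2 * ∫ t in x..y, (1:ℝ) := by
    rw [← hd, ← aux_lin3 1 (-2*s) (s^2) (fun x => deriv u x^2) (fun x => deriv u x) (fun _ => 1)
      (by fun_prop) (by fun_prop) (by fun_prop)]
    exact intervalIntegral.integral_congr fun x _ => by ring
  rw [h3] at h2
  simp only [intervalIntegral.integral_const, smul_eq_mul, mul_one] at h2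
  have hsd : s * (y - x) = d := by rw [hs]; field_simp
  have h4 : s * d ≤ ∫ t in (0:ℝ)..1, (deriv u t)^2 := by
    have : s^2 * (y-x) = s * d := by rw [← hsd]; ring
    rw [this] at h2
    linarith
  calc d^2 = (y-x) * (s * d) := by rw [← hsd]; ring
    _ ≤ _ := mul_le_mul_of_nonneg_left h4 hp.le

lemma aux_Qsplit (μ : ℝ) (u : ℝ → ℝ) (hu : ContDiff ℝ 1 u) :
    ∫ x in (0:ℝ)..1, ((deriv u x)^2 + μ * (u x)^2) =
      (∫ x in (0:ℝ)..1, (deriv u x)^2) + μ * ∫ x in (0:ℝ)..1, (u x)^2 := by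
  have hc : Continuous (deriv u) := hu.continuous_deriv (by norm_num)
  have hc' : Continuous u := hu.continuous
  rw [intervalIntegral.integral_add, intervalIntegral.integral_const_mul]
  all_goals exact Continuous.intervalIntegrable (by fun_prop) _ _

lemma aux_smul (μ c : ℝ) (u : ℝ → ℝ) (hu : H10 u) :
    H10 (fun x => c * u x) ∧ (∫ x in (0:ℝ)..1, (c * u x)^4) = c^4 * (∫ x in (0:ℝ)..1, (u x)^4) ∧
    ∫ x in (0:ℝ)..1, ((deriv (fun x => c * u x) x)^2 + μ * (c * u x)^2) =
      c^2 * ∫ x in (0:ℝ)..1, ((deriv u x)^2 + μ * (u x)^2) := by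
  refine ⟨⟨contDiff_const.mul hu.1, by simp [hu.2.1], by simp [hu.2.2]⟩, ?_, ?_⟩
  · rw [← intervalIntegral.integral_const_mul]
    exact intervalIntegral.integral_congr fun x _ => by ring
  · rw [← intervalIntegral.integral_const_mul]
    refine intervalIntegral.integral_congr fun x _ => ?_
    have : deriv (fun x => c * u x) x = c * deriv u x :=
      deriv_const_mul _ (hu.1.differentiable (by norm_num) x)
    simp only [this]
    ring

lemma aux_low (μ m : ℝ)
    (hm : ∀ u, H10 u → (∫ x in (0:ℝ)..1, (u x)^4) = 1 →
      m ≤ ∫ x in (0:ℝ)..1, ((deriv u x)^2 + μ * (u x)^2)) (u : ℝ → ℝ) (hu : H10 u) :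
    m * √(∫ x in (0:ℝ)..1, (u x)^4) ≤ ∫ x in (0:ℝ)..1, ((deriv u x)^2 + μ * (u x)^2) := by
  set N := ∫ x in (0:ℝ)..1, (u x)^4 with hN
  have hN0 : 0 ≤ N := aux_nonneg _ fun x _ => by positivity
  rcases hN0.eq_or_lt with h | h
  · have h1 := aux_cs u hu.1.continuous
    rw [← hN, ← h] at h1
    have h2 : ∫ x in (0:ℝ)..1, (u x)^2 = 0 := by nlinarith
    rw [aux_Qsplit _ _ hu.1, h2, ← h]
    simpa using aux_nonneg _ fun x _ => sq_nonneg (deriv u x)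
  · set r := √N with hr
    have hr0 : 0 < r := Real.sqrt_pos.2 h
    set s := √r with hs
    have hs0 : 0 < s := Real.sqrt_pos.2 hr0
    have hs2 : s^2 = r := Real.sq_sqrt hr0.le
    have hr2 : r^2 = N := Real.sq_sqrt hN0
    obtain ⟨a1, a2, a3⟩ := aux_smul μ (s⁻¹) u hu
    have := hm _ a1 (by rw [a2, ← hN, ← hr2, ← hs2]; field_simp)
    rw [a3, inv_pow, hs2] at this
    rw [inv_mul_eq_div, le_div_iff₀ hr0] at this
    exact this

lemma aux_nonempty : ∃ u, H10 u ∧ (∫ x in (0:ℝ)..1, (u x)^4) = 1 := by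
  set u : ℝ → ℝ := fun x => x * (1 - x) with hu
  have h1 : H10 u := ⟨by fun_prop, by simp [hu], by simp [hu]⟩
  have h : 0 < ∫ x in (0:ℝ)..1, (u x)^4 := by
    refine intervalIntegral.intervalIntegral_pos_of_pos_on
      (Continuous.intervalIntegrable (by fun_prop) _ _) (fun x hx => ?_) (by norm_num)
    have : 0 < x * (1 - x) := mul_pos hx.1 (by linarith [hx.2])
    positivity
  set N := ∫ x in (0:ℝ)..1, (u x)^4
  obtain ⟨a1, a2, -⟩ := aux_smul 0 (√(√N))⁻¹ u h1
  refine ⟨_, a1, ?_⟩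
  rw [a2]
  have hr0 : 0 < √N := Real.sqrt_pos.2 h
  have : (√(√N))^4 = N := by
    rw [show 4 = 2 * 2 by norm_num, pow_mul, Real.sq_sqrt hr0.le, Real.sq_sqrt h.le]
  rw [inv_pow, this]
  exact inv_mul_cancel₀ h.ne'

lemma aux_phi (g : ℝ → ℝ) (hg : Continuous g) : ∃ φ φ' : ℝ → ℝ,
    (∀ x, HasDerivAt φ (φ' x) x) ∧ (∀ x, HasDerivAt φ' (g x) x) ∧ φ 0 = 0 ∧ φ 1 = 0 := by
  set G : ℝ → ℝ := fun x => ∫ t in (0:ℝ)..x, g t with hG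
  have hG' : ∀ x, HasDerivAt G (g x) x := fun x => (hg.integral_hasStrictDerivAt 0 x).hasDerivAt
  have hGc : Continuous G := continuous_iff_continuousAt.2 fun x => (hG' x).continuousAt
  set c := ∫ t in (0:ℝ)..1, G t with hc
  refine ⟨fun x => (∫ t in (0:ℝ)..x, G t) - x * c, fun x => G x - c, fun x => ?_, fun x => ?_,
    by simp, by simp [hc]⟩
  · have h := (hGc.integral_hasStrictDerivAt 0 x).hasDerivAt.fun_sub
      ((hasDerivAt_id x).mul_const c)
    rw [one_mul] at h
    exact h
  · simpa using (hG' x).sub_const c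

lemma aux_parts (v v' f f' : ℝ → ℝ) (hv : ∀ x, HasDerivAt v (v' x) x)
    (hf : ∀ x, HasDerivAt f (f' x) x) (hv' : Continuous v') (hf' : Continuous f')
    (h0 : v 0 = 0) (h1 : v 1 = 0) :
    ∫ x in (0:ℝ)..1, v' x * f x = - ∫ x in (0:ℝ)..1, v x * f' x := by
  have := intervalIntegral.integral_mul_deriv_eq_deriv_mul (a := 0) (b := 1)
    (fun x _ => hv x) (fun x _ => hf x)
    (hv'.intervalIntegrable _ _) (hf'.intervalIntegrable _ _)
  rw [h0, h1] at this
  linarith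

lemma aux_conv (F : ℕ → ℝ → ℝ) (f G : ℝ → ℝ) (hF : ∀ n, Continuous (F n)) (hG : Continuous G)
    (hb : ∀ n, ∀ x ∈ Icc (0:ℝ) 1, |F n x| ≤ G x)
    (hl : ∀ x ∈ Icc (0:ℝ) 1, Tendsto (fun n => F n x) atTop (𝓝 (f x))) :
    Tendsto (fun n => ∫ x in (0:ℝ)..1, F n x) atTop (𝓝 (∫ x in (0:ℝ)..1, f x)) := by
  have hsub : ∀ x ∈ uIoc (0:ℝ) 1, x ∈ Icc (0:ℝ) 1 := fun x hx => by
    rw [uIoc_of_le (by norm_num)] at hx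
    exact Ioc_subset_Icc_self hx
  refine intervalIntegral.tendsto_integral_filter_of_dominated_convergence G
    (Eventually.of_forall fun n => (hF n).aestronglyMeasurable)
    (Eventually.of_forall fun n => Eventually.of_forall fun x hx => hb n x (hsub x hx))
    (hG.intervalIntegrable _ _) (Eventually.of_forall fun x hx => hl x (hsub x hx))

lemma aux_extract (u : ℕ → ℝ → ℝ) (hu : ∀ n, H10 (u n)) (C : ℝ) (hC : 0 ≤ C)
    (hb : ∀ n, ∫ x in (0:ℝ)..1, (deriv (u n) x)^2 ≤ C^2) :
    (∀ n, ∀ x ∈ Icc (0:ℝ) 1, |u n x| ≤ C) ∧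
    ∃ (w : ℝ → ℝ) (k : ℕ → ℕ), Continuous w ∧ StrictMono k ∧
      ∀ x ∈ Icc (0:ℝ) 1, Tendsto (fun n => u (k n) x) atTop (𝓝 (w x)) := by
  have hH : ∀ n, ∀ x ∈ Icc (0:ℝ) 1, ∀ y ∈ Icc (0:ℝ) 1, |u n x - u n y| ≤ C * √|x - y| := by
    intro n
    have key : ∀ x ∈ Icc (0:ℝ) 1, ∀ y ∈ Icc (0:ℝ) 1, x ≤ y → |u n x - u n y| ≤ C * √|x - y| := by
      intro x hx y hy hxy
      have h := aux_holder (u n) (hu n).1 x y hx.1 hxy hy.2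
      refine abs_le_of_sq_le_sq ?_ (by positivity) |> fun h => h
      rw [mul_pow, Real.sq_sqrt (abs_nonneg _), abs_of_nonpos (by linarith : x - y ≤ 0)]
      nlinarith [hb n]
    intro x hx y hy
    rcases le_total x y with h | h
    · exact key x hx y hy h
    · rw [abs_sub_comm, abs_sub_comm x]; exact key y hy x hx h
  have hB : ∀ n, ∀ x ∈ Icc (0:ℝ) 1, |u n x| ≤ C := by
    intro n x hx
    have h := aux_holder (u n) (hu n).1 0 x le_rfl hx.1 hx.2
    rw [(hu n).2.1] at h
    refine abs_le_of_sq_le_sq ?_ hC |> fun h => h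
    have h0 := aux_nonneg _ fun x _ => sq_nonneg (deriv (u n) x)
    have := hx.2
    nlinarith [hb n, hx.1]
  refine ⟨hB, ?_⟩
  let F : ℕ → BoundedContinuousFunction (Icc (0:ℝ) 1) ℝ := fun n =>
    BoundedContinuousFunction.mkOfCompact
      ⟨fun x => u n x, (hu n).1.continuous.comp continuous_subtype_val⟩
  have hFx : ∀ n x, F n x = u n x := fun n x => rfl
  have hcomp : IsCompact (closure (range F)) := by
    refine BoundedContinuousFunction.arzela_ascoli (Icc (-C) C) isCompact_Icc _ ?_ ?_
    · rintro f x ⟨n, rfl⟩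
      rw [hFx]
      exact abs_le.1 (hB n x x.2)
    · refine Metric.equicontinuous_of_continuity_modulus (fun t => C * √t) ?_ _ ?_
      · have : Continuous fun t : ℝ => C * √t := by fun_prop
        simpa using this.tendsto 0
      · rintro x y ⟨f, n, rfl⟩
        simp only [hFx, Real.dist_eq, Subtype.dist_eq]
        exact hH n x x.2 y y.2
  obtain ⟨f, -, k, hk, hlim⟩ := hcomp.tendsto_subseq (x := F) fun n => subset_closure ⟨n, rfl⟩
  refine ⟨IccExtend (zero_le_one' ℝ) f, k, f.continuous.Icc_extend', hk, fun x hx => ?_⟩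
  rw [IccExtend_of_mem _ _ hx]
  have := ((continuous_eval_const
    (F := BoundedContinuousFunction (Icc (0:ℝ) 1) ℝ) (⟨x, hx⟩ : Icc (0:ℝ) 1)).tendsto f).comp hlim
  exact this

lemma aux_reg (u : ℝ → ℝ) (hu : H10 u) (ε : ℝ) (hε : 0 < ε) :
    ∃ v : ℝ → ℝ, H10 v ∧ (∀ x, |v x - abs (u x)| ≤ ε) ∧ (∀ x, abs (v x) ≤ abs (u x)) ∧
      ∫ x in (0:ℝ)..1, (deriv v x)^2 ≤ ∫ x in (0:ℝ)..1, (deriv u x)^2 := by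
  have hpos : ∀ x, 0 < u x^2 + ε^2 := fun x => by positivity
  have hcd : ContDiff ℝ 1 (fun x => √(u x^2 + ε^2) - ε) := by
    refine ContDiff.sub (ContDiff.sqrt ?_ fun x => (hpos x).ne') contDiff_const
    exact (hu.1.pow 2).add contDiff_const
  have hsq : ∀ x, ε ≤ √(u x^2 + ε^2) := fun x => Real.le_sqrt_of_sq_le (by nlinarith [sq_nonneg (u x)])
  have hsu : ∀ x, |u x| ≤ √(u x^2 + ε^2) := fun x =>
    Real.le_sqrt_of_sq_le (by nlinarith [sq_abs (u x)])
  have hup : ∀ x, √(u x^2 + ε^2) ≤ |u x| + ε := fun x =>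
    Real.sqrt_le_iff.2 ⟨by positivity, by nlinarith [sq_abs (u x), abs_nonneg (u x)]⟩
  refine ⟨fun x => √(u x^2 + ε^2) - ε, ⟨hcd, ?_, ?_⟩, fun x => ?_, fun x => ?_, ?_⟩
  · simp [hu.2.1, Real.sqrt_sq hε.le]
  · simp [hu.2.2, Real.sqrt_sq hε.le]
  · rw [abs_le]; constructor <;> linarith [hsu x, hup x]
  · rw [abs_of_nonneg (by linarith [hsq x])]; linarith [hup x]
  · have hc : Continuous (deriv u) := hu.1.continuous_deriv (by norm_num)
    have hc2 := hcd.continuous_deriv (by norm_num)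
    refine intervalIntegral.integral_mono (by norm_num)
      (Continuous.intervalIntegrable (by fun_prop) _ _)
      (Continuous.intervalIntegrable (by fun_prop) _ _) fun x => ?_
    have hd := (hu.1.differentiable (by norm_num) x).hasDerivAt
    have hd2 := ((((hd.pow 2).add_const (ε^2)).sqrt (hpos x).ne').sub_const ε).deriv
    simp only at hd2 ⊢
    have e : deriv (fun x => √(u x^2 + ε^2) - ε) x = u x * deriv u x / √(u x^2+ε^2) := by
      refine (Eq.trans ?_ hd2).trans ?_
      · rfl
      · simp only [Pi.pow_apply]; field_simp; simp; ring
    rw [e, div_pow, Real.sq_sqrt (hpos x).le, div_le_iff₀ (hpos x)]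
    nlinarith [sq_nonneg (ε * deriv u x)]

lemma aux_ineq (μ m : ℝ) 
    (hlow : ∀ u, H10 u → m * √(∫ x in (0:ℝ)..1, (u x)^4) ≤
      ∫ x in (0:ℝ)..1, ((deriv u x)^2 + μ * (u x)^2))
    (v : ℝ → ℝ) (hv : H10 v) (φ φ' g : ℝ → ℝ) (hφ : ∀ x, HasDerivAt φ (φ' x) x)
    (hφ' : ∀ x, HasDerivAt φ' (g x) x) (hg : Continuous g) (h0 : φ 0 = 0) (h1 : φ 1 = 0) (t : ℝ) :
    m * √(∫ x in (0:ℝ)..1, (v x + t * φ x)^4) ≤ (∫ x in (0:ℝ)..1, (deriv v x)^2)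
      - 2 * t * (∫ x in (0:ℝ)..1, v x * g x) + t^2 * (∫ x in (0:ℝ)..1, (φ' x)^2)
      + μ * ∫ x in (0:ℝ)..1, (v x + t * φ x)^2 := by
  have hφ'c : Continuous φ' := continuous_iff_continuousAt.2 fun x => (hφ' x).continuousAt
  have hφd : deriv φ = φ' := funext fun x => (hφ x).deriv
  have hφ1 : ContDiff ℝ 1 φ := contDiff_one_iff_deriv.2
    ⟨fun x => (hφ x).differentiableAt, by rw [hφd]; exact hφ'c⟩
  have hH : H10 (fun x => v x + t * φ x) :=
    ⟨hv.1.add (contDiff_const.mul hφ1), by simp [hv.2.1, h0], by simp [hv.2.2, h1]⟩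
  have h := hlow _ hH
  rw [aux_Qsplit _ _ hH.1] at h
  have hvc : Continuous (deriv v) := hv.1.continuous_deriv (by norm_num)
  have hvd : ∀ x, HasDerivAt v (deriv v x) x :=
    fun x => (hv.1.differentiable (by norm_num) x).hasDerivAt
  have hd : ∀ x, deriv (fun x => v x + t * φ x) x = deriv v x + t * φ' x := fun x =>
    ((hvd x).add ((hφ x).const_mul t)).deriv
  have e : ∫ x in (0:ℝ)..1, (deriv (fun x => v x + t * φ x) x)^2 =
      1 * (∫ x in (0:ℝ)..1, (deriv v x)^2) + (2*t) * (∫ x in (0:ℝ)..1, deriv v x * φ' x) +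
        t^2 * ∫ x in (0:ℝ)..1, (φ' x)^2 := by
    rw [← aux_lin3 1 (2*t) (t^2) (fun x => deriv v x^2) (fun x => deriv v x * φ' x)
      (fun x => φ' x ^2) (by fun_prop) (by fun_prop) (by fun_prop)]
    refine intervalIntegral.integral_congr fun x _ => ?_
    simp only [hd]
    ring
  rw [e, aux_parts v (deriv v) φ' g hvd hφ' hvc hg hv.2.1 hv.2.2] at h
  linarith

lemma aux_EL (μ m C : ℝ)
    (hlow : ∀ u, H10 u → m * √(∫ x in (0:ℝ)..1, (u x)^4) ≤
      ∫ x in (0:ℝ)..1, ((deriv u x)^2 + μ * (u x)^2))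
    (u : ℕ → ℝ → ℝ) (w : ℝ → ℝ) (δ : ℕ → ℝ) (hu : ∀ n, H10 (u n))
    (hδ : Tendsto δ atTop (𝓝 0)) (hδ0 : ∀ n, 0 < δ n)
    (hN : ∀ n, ∫ x in (0:ℝ)..1, (u n x)^4 = 1)
    (hQ : ∀ n, ∫ x in (0:ℝ)..1, ((deriv (u n) x)^2 + μ * (u n x)^2) ≤ m + δ n)
    (hB : ∀ n, ∀ x ∈ Icc (0:ℝ) 1, |u n x| ≤ C) (hw : Continuous w)
    (hl : ∀ x ∈ Icc (0:ℝ) 1, Tendsto (fun n => u n x) atTop (𝓝 (w x))) :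
    (∫ x in (0:ℝ)..1, |w x|^4 = 1) ∧ 
    ∀ (φ φ' g : ℝ → ℝ), (∀ x, HasDerivAt φ (φ' x) x) → (∀ x, HasDerivAt φ' (g x) x) →
      Continuous g → φ 0 = 0 → φ 1 = 0 →
      ∫ x in (0:ℝ)..1, |w x| * g x = ∫ x in (0:ℝ)..1, (μ * |w x| - m * |w x|^3) * φ x := by
  have huc : ∀ n, Continuous (u n) := fun n => (hu n).1.continuous
  have hC : 0 ≤ C := (abs_nonneg _).trans (hB 0 0 (by simp))
  have hN1 : ∫ x in (0:ℝ)..1, |w x|^4 = 1 := by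
    have h := aux_conv (fun n x => (u n x)^4) (fun x => |w x|^4) (fun _ => C^4)
      (fun n => by fun_prop) (by fun_prop)
      (fun n x hx => by rw [abs_pow]; exact pow_le_pow_left₀ (abs_nonneg _) (hB n x hx) 4)
      (fun x hx => by
        have := ((hl x hx).pow 4)
        rwa [← Even.pow_abs (by decide : Even 4) (w x)] at this)
    simp only [hN] at h
    exact (tendsto_nhds_unique h tendsto_const_nhds)
  refine ⟨hN1, fun φ φ' g hφ hφ' hg h0 h1 => ?_⟩
  have hφc : Continuous φ := continuous_iff_continuousAt.2 fun x => (hφ x).continuousAt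
  choose v hvH hv1 hv2 hv3 using fun n => aux_reg (u n) (hu n) (δ n) (hδ0 n)
  have hvc : ∀ n, Continuous (v n) := fun n => (hvH n).1.continuous
  have hvB : ∀ n, ∀ x ∈ Icc (0:ℝ) 1, |v n x| ≤ C := fun n x hx => (hv2 n x).trans (hB n x hx)
  have hvl : ∀ x ∈ Icc (0:ℝ) 1, Tendsto (fun n => v n x) atTop (𝓝 |w x|) := by
    intro x hx
    have h1 : Tendsto (fun n => v n x - |u n x|) atTop (𝓝 0) :=
      squeeze_zero_norm (fun n => hv1 n x) hδ
    simpa using h1.add (hl x hx).abs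
  have hbd : ∀ t n, ∀ x ∈ Icc (0:ℝ) 1, |v n x + t * φ x| ≤ C + |t * φ x| := fun t n x hx =>
    (abs_add_le _ _).trans (by linarith [hvB n x hx])
  have hpow : ∀ (t : ℝ) (k : ℕ), Tendsto (fun n => ∫ x in (0:ℝ)..1, (v n x + t * φ x)^k) atTop
      (𝓝 (∫ x in (0:ℝ)..1, (|w x| + t * φ x)^k)) := fun t k =>
    aux_conv _ _ (fun x => (C + |t * φ x|)^k) (fun n => by fun_prop) (by fun_prop)
      (fun n x hx => by rw [abs_pow]; exact pow_le_pow_left₀ (abs_nonneg _) (hbd t n x hx) k)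
      (fun x hx => ((hvl x hx).add_const _).pow k)
  have hu2 : Tendsto (fun n => ∫ x in (0:ℝ)..1, (u n x)^2) atTop
      (𝓝 (∫ x in (0:ℝ)..1, |w x|^2)) := 
    aux_conv _ _ (fun x => C^2) (fun n => by fun_prop) (by fun_prop)
      (fun n x hx => by rw [abs_pow]; exact pow_le_pow_left₀ (abs_nonneg _) (hB n x hx) 2)
      (fun x hx => by rw [sq_abs]; exact (hl x hx).pow 2)
  have hvg : Tendsto (fun n => ∫ x in (0:ℝ)..1, v n x * g x) atTop
      (𝓝 (∫ x in (0:ℝ)..1, |w x| * g x)) := 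
    aux_conv _ _ (fun x => C * |g x|) (fun n => by fun_prop) (by fun_prop)
      (fun n x hx => by
        rw [abs_mul]; exact mul_le_mul_of_nonneg_right (hvB n x hx) (abs_nonneg _))
      (fun x hx => (hvl x hx).mul_const _)
  have key : ∀ t : ℝ, m * √(∫ x in (0:ℝ)..1, (|w x| + t * φ x)^4) ≤
      (m + 0 - μ * ∫ x in (0:ℝ)..1, |w x|^2)
      - 2 * t * (∫ x in (0:ℝ)..1, |w x| * g x) + t^2 * (∫ x in (0:ℝ)..1, (φ' x)^2)
      + μ * ∫ x in (0:ℝ)..1, (|w x| + t * φ x)^2 := by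
    intro t
    refine le_of_tendsto_of_tendsto'
      (((Real.continuous_sqrt.tendsto _).comp (hpow t 4)).const_mul m)
      (((((hδ.const_add m).sub (hu2.const_mul μ)).sub (hvg.const_mul (2*t))).add_const _).add
        ((hpow t 2).const_mul μ)) fun n => ?_
    have h := aux_ineq μ m hlow (v n) (hvH n) φ φ' g hφ hφ' hg h0 h1 t
    have h' := hQ n
    rw [aux_Qsplit _ _ (hu n).1] at h'
    simp only [Function.comp]
    linarith [hv3 n]
  clear hpow hbd hvl hvB hu2 hvg
  -- expand
  have e2 : ∀ t : ℝ, ∫ x in (0:ℝ)..1, (|w x| + t * φ x)^2 = 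
      1 * (∫ x in (0:ℝ)..1, |w x|^2) + (2*t) * (∫ x in (0:ℝ)..1, |w x| * φ x) +
        t^2 * ∫ x in (0:ℝ)..1, (φ x)^2 := by
    intro t
    rw [← aux_lin3 1 (2*t) (t^2) (fun x => |w x|^2) (fun x => |w x| * φ x)
      (fun x => φ x ^2) (by fun_prop) (by fun_prop) (by fun_prop)]
    exact intervalIntegral.integral_congr fun x _ => by ring
  have e4 : ∀ t : ℝ, ∫ x in (0:ℝ)..1, (|w x| + t * φ x)^4 = 
      1 * (1 * (∫ x in (0:ℝ)..1, |w x|^4) + (4*t) * (∫ x in (0:ℝ)..1, |w x|^3 * φ x) +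
        (6*t^2) * ∫ x in (0:ℝ)..1, |w x|^2 * (φ x)^2) + (4*t^3) * (∫ x in (0:ℝ)..1, |w x| * φ x^3)
        + t^4 * (∫ x in (0:ℝ)..1, φ x^4) := by
    intro t
    rw [← aux_lin3 1 (4*t) (6*t^2) (fun x => |w x|^4) (fun x => |w x|^3 * φ x)
      (fun x => |w x|^2 * φ x ^2) (by fun_prop) (by fun_prop) (by fun_prop),
      ← aux_lin3 1 (4*t^3) (t^4) _ (fun x => |w x| * φ x^3)
      (fun x => φ x ^4) (by fun_prop) (by fun_prop) (by fun_prop)]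
    exact intervalIntegral.integral_congr fun x _ => by ring
  have e3 : ∫ x in (0:ℝ)..1, (μ * |w x| - m * |w x|^3) * φ x =
      μ * (∫ x in (0:ℝ)..1, |w x| * φ x) + (-m) * (∫ x in (0:ℝ)..1, |w x|^3 * φ x) + 
      0 * ∫ x in (0:ℝ)..1, (1:ℝ) := by
    rw [← aux_lin3 μ (-m) 0 (fun x => |w x| * φ x) (fun x => |w x|^3 * φ x)
      (fun x => 1) (by fun_prop) (by fun_prop) (by fun_prop)]
    exact intervalIntegral.integral_congr fun x _ => by ring
  simp only [e2, e4, hN1] at key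
  rw [e3]
  generalize (∫ x in (0:ℝ)..1, |w x|^2) = A at *
  generalize (∫ x in (0:ℝ)..1, |w x| * g x) = B at *
  generalize (∫ x in (0:ℝ)..1, (φ' x)^2) = D at *
  generalize (∫ x in (0:ℝ)..1, |w x| * φ x) = E at *
  generalize (∫ x in (0:ℝ)..1, (φ x)^2) = F at *
  generalize (∫ x in (0:ℝ)..1, |w x|^3 * φ x) = G at *
  generalize (∫ x in (0:ℝ)..1, |w x|^2 * (φ x)^2) = H at *
  generalize (∫ x in (0:ℝ)..1, |w x| * φ x^3) = K at *
  generalize (∫ x in (0:ℝ)..1, φ x^4) = L at *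
  have p1 : HasDerivAt (fun t : ℝ => 1 + 4*G*t + 6*H*t^2 + 4*K*t^3+L*t^4) (4*G) 0 := by
    have := (((((hasDerivAt_id (0:ℝ)).const_mul (4*G)).const_add 1).add
      (((hasDerivAt_id (0:ℝ)).pow 2).const_mul (6*H))).add
      (((hasDerivAt_id (0:ℝ)).pow 3).const_mul (4*K))).add
      (((hasDerivAt_id (0:ℝ)).pow 4).const_mul L)
    exact this.congr_deriv (by simp)
  have p2 := ((p1.sqrt (by norm_num)).const_mul m)
  have p3 : HasDerivAt (fun t : ℝ => m + (2*μ*E-2*B)*t + (D+μ*F)*t^2) (2*μ*E-2*B) 0 := by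
    have := (((hasDerivAt_id (0:ℝ)).const_mul (2*μ*E-2*B)).const_add m).add
      (((hasDerivAt_id (0:ℝ)).pow 2).const_mul (D+μ*F))
    exact this.congr_deriv (by simp)
  have p4 := p3.fun_sub p2
  have hmin : IsLocalMin (fun t : ℝ => (m + (2*μ*E-2*B)*t + (D+μ*F)*t^2) - 
      m * √(1 + 4*G*t + 6*H*t^2 + 4*K*t^3+L*t^4)) 0 := by
    refine Eventually.of_forall fun t => ?_
    have h := key t
    rw [show 1 * (1 * 1 + 4 * t * G + 6 * t ^ 2 * H) + 4 * t ^ 3 * K + t ^ 4 * L =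
      1 + 4*G*t + 6*H*t^2 + 4*K*t^3+L*t^4 by ring] at h
    simp
    linarith
  have h := hmin.hasDerivAt_eq_zero p4
  simp at h
  linarith

lemma aux_unique (h h' f : ℝ → ℝ) (q : ℝ → ℝ) (M : ℝ) (hh : ∀ x, HasDerivAt h (h' x) x)
    (hh' : ∀ x, HasDerivAt h' (f x) x) (hf : ∀ x ∈ Icc (0:ℝ) 1, f x = q x * h x)
    (hq : ∀ x ∈ Icc (0:ℝ) 1, |q x| ≤ M) (c : ℝ) (hc : c ∈ Icc (0:ℝ) 1) (h0 : h c = 0)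
    (h1 : h' c = 0) : ∀ x ∈ Icc (0:ℝ) 1, h x = 0 := by
  set E : ℝ → ℝ := fun x => h x ^2 + h' x^2 with hE
  have hEd : ∀ x, HasDerivAt E (2 * h x * h' x + 2 * h' x * f x) x := fun x => by
    exact (((hh x).pow 2).add ((hh' x).pow 2)).congr_deriv (by simp)
  have hEb : ∀ x ∈ Icc (0:ℝ) 1, |2 * h x * h' x + 2 * h' x * f x| ≤ (1 + M) * E x := by
    intro x hx
    rw [hf x hx]
    have e : 2 * h x * h' x + 2 * h' x * (q x * h x) = (1 + q x) * (2 * h x * h' x) := by ring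
    rw [e, abs_mul]
    have a1 : |1 + q x| ≤ 1 + M := (abs_add_le _ _).trans (by simpa using hq x hx)
    have a2 : |2 * h x * h' x| ≤ E x := by
      rw [abs_le]
      constructor <;> simp only [hE] <;> nlinarith [sq_nonneg (h x + h' x), sq_nonneg (h x - h' x)]
    exact mul_le_mul a1 a2 (abs_nonneg _) ((abs_nonneg _).trans a1)
  have hexp : ∀ K x : ℝ, HasDerivAt (fun x => E x * Real.exp (K * x))
      ((2 * h x * h' x + 2 * h' x * f x + K * E x) * Real.exp (K * x)) x := fun K x => by
    have := (hEd x).mul (((hasDerivAt_id x).const_mul K).exp)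
    exact this.congr_deriv (by simp; ring)
  have hcont : ∀ K : ℝ, Continuous (fun x => E x * Real.exp (K * x)) := fun K =>
    continuous_iff_continuousAt.2 fun x => (hexp K x).continuousAt
  have hmono : MonotoneOn (fun x => E x * Real.exp ((1+M) * x)) (Icc 0 1) := by
    refine monotoneOn_of_deriv_nonneg (convex_Icc 0 1) (hcont _).continuousOn
      (fun x _ => (hexp _ x).differentiableAt.differentiableWithinAt) fun x hx => ?_
    rw [(hexp _ x).deriv]
    have := neg_abs_le (2 * h x * h' x + 2 * h' x * f x)
    have := hEb x (interior_subset hx)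
    exact mul_nonneg (by linarith) (Real.exp_pos _).le
  have hanti : AntitoneOn (fun x => E x * Real.exp ((-(1+M)) * x)) (Icc 0 1) := by
    refine antitoneOn_of_deriv_nonpos (convex_Icc 0 1) (hcont _).continuousOn
      (fun x _ => (hexp _ x).differentiableAt.differentiableWithinAt) fun x hx => ?_
    rw [(hexp _ x).deriv]
    have := le_abs_self (2 * h x * h' x + 2 * h' x * f x)
    have := hEb x (interior_subset hx)
    exact mul_nonpos_of_nonpos_of_nonneg (by linarith) (Real.exp_pos _).le
  have hEc : E c = 0 := by simp [hE, h0, h1]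
  intro x hx
  have hEx : E x ≤ 0 := by
    rcases le_total x c with hxc | hxc
    · have := hmono hx hc hxc
      simp only [hEc, zero_mul] at this
      exact nonpos_of_mul_nonpos_left this (Real.exp_pos _)
    · have := hanti hc hx hxc
      simp only [hEc, zero_mul] at this
      exact nonpos_of_mul_nonpos_left this (Real.exp_pos _)
  simp only [hE] at hEx
  nlinarith [sq_nonneg (h x), sq_nonneg (h' x)]

/-- For μ > −π² there is a positive minimizer w ∈ H¹₀(0,1) of
J[u] = (1/2)∫₀¹(u'² + μu²) subject to ∫₀¹ u⁴ = 1. -/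
theorem exists_positive_constrained_minimizer (μ : ℝ) (hμ : -(π^2) < μ) :
    ∃ w : ℝ → ℝ, H10 w ∧ (∀ x ∈ Set.Ioo (0:ℝ) 1, 0 < w x) ∧
      (∫ x in (0:ℝ)..1, (w x)^4) = 1 ∧
      ∀ u : ℝ → ℝ, H10 u → (∫ x in (0:ℝ)..1, (u x)^4) = 1 →
        (1/2) * (∫ x in (0:ℝ)..1, ((deriv w x)^2 + μ * (w x)^2)) ≤
        (1/2) * (∫ x in (0:ℝ)..1, ((deriv u x)^2 + μ * (u x)^2)) := by
  set S : Set ℝ := {q | ∃ u, H10 u ∧ (∫ x in (0:ℝ)..1, (u x)^4) = 1 ∧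
    q = ∫ x in (0:ℝ)..1, ((deriv u x)^2 + μ * (u x)^2)} with hS
  have hL2 : ∀ u, H10 u → (∫ x in (0:ℝ)..1, (u x)^4) = 1 →
      |μ * ∫ x in (0:ℝ)..1, (u x)^2| ≤ |μ| := by
    intro u hu hN
    have h1 := aux_cs u hu.1.continuous
    have h0 := aux_nonneg _ fun x _ => sq_nonneg (u x)
    rw [hN] at h1
    rw [abs_mul, abs_of_nonneg h0]
    exact mul_le_of_le_one_right (abs_nonneg _) (by nlinarith)
  have hbdd : BddBelow S := by
    refine ⟨-|μ|, ?_⟩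
    rintro q ⟨u, hu, hN, rfl⟩
    rw [aux_Qsplit _ _ hu.1]
    have h0 := aux_nonneg _ fun x _ => sq_nonneg (deriv u x)
    linarith [(abs_le.1 (hL2 u hu hN)).1]
  have hne : S.Nonempty := by
    obtain ⟨u, hu, hN⟩ := aux_nonempty
    exact ⟨_, u, hu, hN, rfl⟩
  set m := sInf S with hm
  have hmin : ∀ u, H10 u → (∫ x in (0:ℝ)..1, (u x)^4) = 1 →
      m ≤ ∫ x in (0:ℝ)..1, ((deriv u x)^2 + μ * (u x)^2) := fun u hu hN =>
    csInf_le hbdd ⟨u, hu, hN, rfl⟩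
  have hlow := aux_low μ m hmin
  have hseq : ∀ n : ℕ, ∃ u, H10 u ∧ (∫ x in (0:ℝ)..1, (u x)^4) = 1 ∧
      ∫ x in (0:ℝ)..1, ((deriv u x)^2 + μ * (u x)^2) ≤ m + 1 / ((n:ℝ) + 1) := by
    intro n
    obtain ⟨q, ⟨u, hu, hN, rfl⟩, hq⟩ := exists_lt_of_csInf_lt hne
      (show sInf S < m + 1 / ((n:ℝ) + 1) by
        have : 0 < 1 / ((n:ℝ) + 1) := by positivity
        linarith)
    exact ⟨u, hu, hN, hq.le⟩
  choose u hu hN hQ using hseq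
  set C := |m| + |μ| + 1 with hC
  have hC1 : 1 ≤ C := by linarith [abs_nonneg m, abs_nonneg μ]
  obtain ⟨hB, w0, k, hw0, hk, hlim⟩ := aux_extract u hu C (by linarith) (fun n => by
    have h := hQ n
    rw [aux_Qsplit _ _ (hu n).1] at h
    have h2 := (abs_le.1 (hL2 _ (hu n) (hN n))).1
    have h3 : 1 / ((n:ℝ) + 1) ≤ 1 := by
      rw [div_le_one (by positivity)]
      linarith [n.cast_nonneg (α := ℝ)]
    have : C ≤ C^2 := by nlinarith
    linarith [le_abs_self m])
  obtain ⟨hw4, hEL⟩ := aux_EL μ m C hlow (fun n => u (k n)) w0 (fun n => 1 / ((k n : ℝ) + 1))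
    (fun n => hu _) (tendsto_one_div_add_atTop_nhds_zero_nat.comp hk.tendsto_atTop)
    (fun n => by positivity) (fun n => hN _) (fun n => hQ _) (fun n => hB _) hw0 hlim
  set w : ℝ → ℝ := fun x => |w0 x| with hw
  have hwc : Continuous w := by fun_prop
  have hw00 : ∀ x, 0 ≤ w x := fun x => abs_nonneg _
  change ∫ x in (0:ℝ)..1, w x^4 = 1 at hw4
  change ∀ (φ φ' g : ℝ → ℝ), (∀ x, HasDerivAt φ (φ' x) x) → (∀ x, HasDerivAt φ' (g x) x) →
      Continuous g → φ 0 = 0 → φ 1 = 0 →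
      ∫ x in (0:ℝ)..1, w x * g x = ∫ x in (0:ℝ)..1, (μ * w x - m * w x^3) * φ x at hEL
  clear_value w
  set f : ℝ → ℝ := fun x => μ * w x - m * w x^3 with hf
  have hfc : Continuous f := by fun_prop
  obtain ⟨h, h', hh, hh', h0, h1⟩ := aux_phi f hfc
  have hhc : Continuous h := continuous_iff_continuousAt.2 fun x => (hh x).continuousAt
  have hhc' : Continuous h' := continuous_iff_continuousAt.2 fun x => (hh' x).continuousAt
  have hzero : ∫ x in (0:ℝ)..1, (w x - h x)^2 = 0 := by
    have hgc : Continuous (fun x => w x - h x) := by fun_prop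
    obtain ⟨φ, φ', hφ, hφ', φ0, φ1⟩ := aux_phi (fun x => w x - h x) hgc
    have hφc : Continuous φ' := continuous_iff_continuousAt.2 fun x => (hφ' x).continuousAt
    have a := hEL φ φ' _ hφ hφ' hgc φ0 φ1
    have b := aux_parts φ φ' h' f hφ hh' hφc hfc φ0 φ1
    have c := aux_parts h h' φ' _ hh hφ' hhc' hgc h0 h1
    have b1 : ∫ x in (0:ℝ)..1, φ' x * h' x = ∫ x in (0:ℝ)..1, h' x * φ' x :=
      intervalIntegral.integral_congr fun x _ => by ring
    have b2 : ∫ x in (0:ℝ)..1, φ x * f x = ∫ x in (0:ℝ)..1, (μ * w x - m * w x^3) * φ x :=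
      intervalIntegral.integral_congr fun x _ => by simp only [hf]; ring
    have b3 : ∫ x in (0:ℝ)..1, (w x - h x)^2 = (∫ x in (0:ℝ)..1, w x * (w x - h x)) -
        ∫ x in (0:ℝ)..1, h x * (w x - h x) := by
      rw [← intervalIntegral.integral_sub]
      · exact intervalIntegral.integral_congr fun x _ => by ring
      all_goals exact Continuous.intervalIntegrable (by fun_prop) _ _
    rw [b3]
    linarith
  have heq : ∀ x ∈ Icc (0:ℝ) 1, h x = w x := by
    intro x hx
    by_contra hne
    have := intervalIntegral.integral_pos (a := 0) (b := 1) (f := fun x => (w x - h x)^2)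
      (by norm_num) (by fun_prop) (fun x _ => sq_nonneg _)
      ⟨x, hx, by have : w x - h x ≠ 0 := fun e => hne (by linarith)
                 positivity⟩
    linarith
  have huIcc : uIcc (0:ℝ) 1 = Icc 0 1 := uIcc_of_le (by norm_num)
  have hh4 : ∫ x in (0:ℝ)..1, h x^4 = 1 := by
    refine Eq.trans ?_ hw4
    refine intervalIntegral.integral_congr fun x hx => ?_
    simp only [heq x (huIcc ▸ hx)]
  have hder : deriv h = h' := funext fun x => (hh x).deriv
  have hh1 : ContDiff ℝ 1 h := contDiff_one_iff_deriv.2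
    ⟨fun x => (hh x).differentiableAt, by rw [hder]; exact hhc'⟩
  refine ⟨h, ⟨hh1, h0, h1⟩, ?_, hh4, ?_⟩
  · intro c hc
    have hcI := Ioo_subset_Icc_self hc
    have hc0 : 0 ≤ h c := by rw [heq c hcI]; exact hw00 c
    refine lt_of_le_of_ne hc0 fun hc1 => ?_
    have hlm : IsLocalMin h c := by
      filter_upwards [Icc_mem_nhds hc.1 hc.2] with x hx
      rw [← hc1, heq x hx]
      exact hw00 x
    have hd := hlm.hasDerivAt_eq_zero (hh c)
    obtain ⟨M, hM⟩ := isCompact_Icc.exists_bound_of_continuousOn (s := Icc (0:ℝ) 1)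
      (f := fun x => μ - m * w x^2) (by fun_prop)
    have hz := aux_unique h h' f (fun x => μ - m * w x^2) M hh hh'
      (fun x hx => by rw [heq x hx]; simp only [hf]; ring) hM c hcI hc1.symm hd
    have : ∫ x in (0:ℝ)..1, h x^4 = ∫ x in (0:ℝ)..1, (0:ℝ) :=
      intervalIntegral.integral_congr fun x hx => by simp [hz x (huIcc ▸ hx)]
    rw [hh4] at this
    simp at this
  · intro v hv hNv
    refine mul_le_mul_of_nonneg_left (le_trans (le_of_eq ?_) (hmin v hv hNv)) (by norm_num)
    rw [aux_Qsplit _ _ hh1, hder]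
    have a := aux_parts h h' h' f hh hh' hhc' hfc h0 h1
    have a1 : ∫ x in (0:ℝ)..1, h' x * h' x = ∫ x in (0:ℝ)..1, h' x ^2 :=
      intervalIntegral.integral_congr fun x _ => by ring
    have a2 : ∫ x in (0:ℝ)..1, h x * f x =
        μ * (∫ x in (0:ℝ)..1, h x^2) + (-m) * (∫ x in (0:ℝ)..1, h x^4) +
          0 * ∫ x in (0:ℝ)..1, (1:ℝ) := by
      rw [← aux_lin3 μ (-m) 0 (fun x => h x^2) (fun x => h x^4) (fun _ => 1)
        (by fun_prop) (by fun_prop) (by fun_prop)]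
      refine intervalIntegral.integral_congr fun x hx => ?_
      simp only [hf, ← heq x (huIcc ▸ hx)]
      ring
    rw [hh4] at a2
    linarith
end

section
/- Let φ be the positive ground state as above and L₊ = −d²/dx² + μ − 3φ² with Dirichlet conditions on (0,1). Then L₊ has exactly one negative eigenvalue, all other eigenvalues are strictly positive, and ker(L₊) = {0}. -/
open Real Set intervalIntegral

/-- Domain of the Sturm–Liouville operators: C² functions with Dirichlet conditions. -/
def Dom2 (u : ℝ → ℝ) : Prop := ContDiff ℝ 2 u ∧ u 0 = 0 ∧ u 1 = 0

/-- The operator L₊ = −d²/dx² + μ − 3φ². -/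
noncomputable def Lplus (μ : ℝ) (φ u : ℝ → ℝ) (x : ℝ) : ℝ :=
  -(deriv (deriv u) x) + μ * u x - 3 * (φ x)^2 * u x

/-- lam is an eigenvalue of L₊ with Dirichlet conditions on (0,1). -/
def IsEigenvalue (μ : ℝ) (φ : ℝ → ℝ) (lam : ℝ) : Prop :=
  ∃ v : ℝ → ℝ, Dom2 v ∧ (∫ x in (0:ℝ)..1, (v x)^2) ≠ 0 ∧
    ∀ x ∈ Set.Ioo (0:ℝ) 1, Lplus μ φ v x = lam * v x

/-- C² solutions of `v'' = p v` on `[0,1]`. -/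
def Sol (p v : ℝ → ℝ) : Prop :=
  ContDiff ℝ 2 v ∧ ∀ x ∈ Icc (0:ℝ) 1, deriv (deriv v) x = p x * v x

lemma c2_deriv {v : ℝ → ℝ} (h : ContDiff ℝ 2 v) (x : ℝ) : HasDerivAt v (deriv v x) x :=
  (h.differentiable (by norm_num) x).hasDerivAt

lemma c2_deriv_c1 {v : ℝ → ℝ} (h : ContDiff ℝ 2 v) : ContDiff ℝ 1 (deriv v) := by
  have h' : ContDiff ℝ (1 + 1) v := by
    convert h using 1
    norm_num
  exact (contDiff_succ_iff_deriv.1 h').2.2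

lemma c2_deriv2 {v : ℝ → ℝ} (h : ContDiff ℝ 2 v) (x : ℝ) :
    HasDerivAt (deriv v) (deriv (deriv v) x) x :=
  ((c2_deriv_c1 h).differentiable (by norm_num) x).hasDerivAt

lemma c2_cont2 {v : ℝ → ℝ} (h : ContDiff ℝ 2 v) : Continuous (deriv (deriv v)) :=
  (contDiff_one_iff_deriv.1 (c2_deriv_c1 h)).2

lemma ext_Icc {f g : ℝ → ℝ} (hf : Continuous f) (hg : Continuous g)
    (h : ∀ x ∈ Ioo (0:ℝ) 1, f x = g x) : ∀ x ∈ Icc (0:ℝ) 1, f x = g x := by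
  have h1 : closure (Ioo (0:ℝ) 1) ⊆ {x | f x = g x} :=
    closure_minimal (fun x hx => h x hx) (isClosed_eq hf hg)
  rw [closure_Ioo (by norm_num)] at h1
  exact fun x hx => h1 hx

lemma exists_bd {p : ℝ → ℝ} (hp : Continuous p) :
    ∃ M : ℝ, 1 ≤ M ∧ ∀ x ∈ Icc (0:ℝ) 1, |p x| ≤ M := by
  obtain ⟨C, hC⟩ := (isCompact_Icc (a := (0:ℝ)) (b := 1)).exists_bound_of_continuousOn
    hp.continuousOn
  exact ⟨max 1 C, le_max_left _ _, fun x hx => (hC x hx).trans (le_max_right _ _)⟩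

lemma field_norm_le {M p y z : ℝ} (hM : 1 ≤ M) (hp : |p| ≤ M) :
    ‖((z, p * y) : ℝ × ℝ)‖ ≤ M * ‖((y, z) : ℝ × ℝ)‖ := by
  have hy : |y| ≤ ‖((y, z) : ℝ × ℝ)‖ := norm_fst_le ((y, z) : ℝ × ℝ)
  have hz : |z| ≤ ‖((y, z) : ℝ × ℝ)‖ := norm_snd_le ((y, z) : ℝ × ℝ)
  have h0 := norm_nonneg ((y, z) : ℝ × ℝ)
  refine norm_prod_le_iff.2 ⟨?_, ?_⟩
  · show |z| ≤ _
    nlinarith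
  · show |p * y| ≤ _
    rw [abs_mul]
    exact mul_le_mul hp hy (abs_nonneg _) (by linarith)

lemma sol_uniq {p v : ℝ → ℝ} (hp : Continuous p) (hv : Sol p v) {t : ℝ} (ht : t ∈ Icc (0:ℝ) 1)
    (h0 : v t = 0) (h1 : deriv v t = 0) : ∀ x ∈ Icc (0:ℝ) 1, v x = 0 := by
  obtain ⟨M, hM, hb⟩ := exists_bd hp
  have hc := hv.1.continuous
  have hc1 := (c2_deriv_c1 hv.1).continuous
  have fwd : ∀ x ∈ Icc t 1, ((v x, deriv v x) : ℝ × ℝ) = 0 := by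
    apply eq_zero_of_abs_deriv_le_mul_abs_self_of_eq_zero_right (K := M)
      (f' := fun x => (deriv v x, deriv (deriv v) x))
    · exact (hc.prodMk hc1).continuousOn
    · exact fun x _ => ((c2_deriv hv.1 x).prodMk (c2_deriv2 hv.1 x)).hasDerivWithinAt
    · simp [h0, h1]
    · intro x hx
      have hx' : x ∈ Icc (0:ℝ) 1 := ⟨ht.1.trans hx.1, hx.2.le⟩
      rw [hv.2 x hx']
      exact field_norm_le hM (hb x hx')
  have bwd : ∀ s ∈ Icc 0 t, ((v (t - s), deriv v (t - s)) : ℝ × ℝ) = 0 := by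
    apply eq_zero_of_abs_deriv_le_mul_abs_self_of_eq_zero_right (K := M)
      (f' := fun s => -(deriv v (t - s), deriv (deriv v) (t - s)))
    · exact Continuous.continuousOn (by fun_prop)
    · intro s _
      have e : HasDerivAt (fun s : ℝ => t - s) (-1) s := by
        simpa using (hasDerivAt_id s).const_sub t
      have a1 := (c2_deriv hv.1 (t - s)).comp s e
      have a2 := (c2_deriv2 hv.1 (t - s)).comp s e
      have := (a1.prodMk a2).hasDerivWithinAt (s := Ici s)
      have e2 : -((deriv v (t - s), deriv (deriv v) (t - s)) : ℝ × ℝ)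
          = (deriv v (t - s) * -1, deriv (deriv v) (t - s) * -1) := by
        simp
      rw [e2]
      exact this
    · simp [h0, h1]
    · intro s hs
      have hx' : t - s ∈ Icc (0:ℝ) 1 := ⟨by linarith [hs.2], by linarith [hs.1, ht.2]⟩
      rw [norm_neg, hv.2 _ hx']
      exact field_norm_le hM (hb _ hx')
  intro x hx
  rcases le_total t x with h | h
  · exact (Prod.ext_iff.1 (fwd x ⟨h, hx.2⟩)).1
  · have := (Prod.ext_iff.1 (bwd (t - x) ⟨by linarith, by linarith [hx.1]⟩)).1
    simpa using this

/-- truncation -/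
noncomputable def clampR (R y : ℝ) : ℝ := max (-R) (min y R)

lemma clampR_abs {R : ℝ} (hR : 0 ≤ R) (y : ℝ) : |clampR R y| ≤ R := by
  unfold clampR
  exact abs_le.2 ⟨le_max_left _ _, max_le (by linarith) (min_le_right _ _)⟩

lemma clampR_abs_le {R : ℝ} (hR : 0 ≤ R) (y : ℝ) : |clampR R y| ≤ |y| := by
  unfold clampR
  rcases max_cases (-R) (min y R) with h | h <;> rcases min_cases y R with h' | h' <;>
    rw [abs_le] <;> constructor <;> rcases abs_cases y with h'' | h'' <;> linarith

lemma clampR_eq {R y : ℝ} (h : |y| ≤ R) : clampR R y = y := by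
  unfold clampR
  rw [min_eq_left (abs_le.1 h).2, max_eq_right (abs_le.1 h).1]

lemma clampR_lip (R x y : ℝ) : |clampR R x - clampR R y| ≤ |x - y| := by
  unfold clampR
  rw [max_comm (-R), max_comm (-R)]
  exact (abs_max_sub_max_le_abs _ _ _).trans (abs_inf_sub_inf_le_abs _ _ _)

lemma exists_sol {p : ℝ → ℝ} (hp : Continuous p) :
    ∃ u : ℝ → ℝ, Sol p u ∧ u 0 = 0 ∧ deriv u 0 = 1 := by
  obtain ⟨M, hM, hb⟩ := exists_bd hp
  have hM0 : 0 ≤ M := by linarith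
  set R : ℝ := Real.exp M with hR
  have hR0 : 0 ≤ R := (Real.exp_pos _).le
  let f : ℝ → ℝ × ℝ → ℝ × ℝ := fun t x => (clampR R x.2, p t * clampR R x.1)
  have hpl : IsPicardLindelof f (⟨0, by simp⟩ : Icc (0:ℝ) 1) ((0:ℝ), (1:ℝ))
      ⟨M * R, by positivity⟩ 0 ⟨M * R, by positivity⟩ ⟨M, hM0⟩ := by
    constructor
    · intro t ht
      apply LipschitzWith.lipschitzOnWith
      apply LipschitzWith.of_dist_le_mul
      intro x y
      rw [dist_eq_norm, dist_eq_norm]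
      have e : f t x - f t y = (clampR R x.2 - clampR R y.2,
          p t * (clampR R x.1 - clampR R y.1)) := by
        ext <;> (simp [f]; try ring)
      rw [e]
      refine (field_norm_le hM (hb t ht)).trans ?_
      show M * _ ≤ M * _
      refine mul_le_mul_of_nonneg_left ?_ hM0
      refine norm_prod_le_iff.2 ⟨?_, ?_⟩
      · exact (clampR_lip R _ _).trans (norm_fst_le (x - y))
      · exact (clampR_lip R _ _).trans (norm_snd_le (x - y))
    · intro x _
      exact Continuous.continuousOn (by fun_prop)
    · intro t ht x _
      refine (field_norm_le hM (hb t ht)).trans ?_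
      show M * _ ≤ M * R
      refine mul_le_mul_of_nonneg_left ?_ hM0
      exact norm_prod_le_iff.2 ⟨clampR_abs hR0 _, clampR_abs hR0 _⟩
    · show M * R * max ((1:ℝ) - 0) (0 - 0) ≤ M * R - 0
      norm_num
  obtain ⟨α, h0, hα⟩ := hpl.exists_eq_forall_mem_Icc_hasDerivWithinAt₀
  replace h0 : α 0 = (0, 1) := h0
  have hαc : ContinuousOn α (Icc 0 1) := fun t ht => (hα t ht).continuousWithinAt
  have hα' : ∀ t ∈ Ico (0:ℝ) 1, HasDerivWithinAt α (f t (α t)) (Ici t) t := by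
    intro t ht
    refine (hα t ⟨ht.1, ht.2.le⟩).mono_of_mem_nhdsWithin ?_
    exact Icc_mem_nhdsGE_of_mem ht
  have hbd : ∀ t ∈ Icc (0:ℝ) 1, ‖α t‖ ≤ R := by
    intro t ht
    have := norm_le_gronwallBound_of_norm_deriv_right_le (δ := 1) (K := M) (ε := 0) hαc hα'
      (by rw [h0]; simp [Prod.norm_def]) (by
        intro s hs
        rw [add_zero]
        refine (field_norm_le hM (hb s ⟨hs.1, hs.2.le⟩)).trans ?_
        refine mul_le_mul_of_nonneg_left ?_ hM0
        refine norm_prod_le_iff.2 ⟨?_, ?_⟩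
        · exact (clampR_abs_le hR0 _).trans (norm_fst_le (α s))
        · exact (clampR_abs_le hR0 _).trans (norm_snd_le (α s))) t ht
    rw [gronwallBound_ε0] at this
    refine this.trans ?_
    rw [one_mul, hR]
    apply Real.exp_le_exp.2
    nlinarith [ht.2]
  have hf : ∀ t ∈ Icc (0:ℝ) 1, f t (α t) = ((α t).2, p t * (α t).1) := by
    intro t ht
    have a1 := clampR_eq ((norm_fst_le (α t)).trans (hbd t ht))
    have a2 := clampR_eq ((norm_snd_le (α t)).trans (hbd t ht))
    simp only [f, a1, a2]
  -- extension
  let w : ℝ → ℝ := fun x => p x * (Set.IccExtend (zero_le_one' ℝ) (fun t => (α t).1)) x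
  have hw : Continuous w := by
    refine hp.mul ?_
    refine Continuous.Icc_extend' ?_
    exact continuous_fst.comp (continuousOn_iff_continuous_domRestrict.1 hαc)
  have hwα : ∀ x ∈ Icc (0:ℝ) 1, w x = p x * (α x).1 := by
    intro x hx
    simp only [w]
    rw [Set.IccExtend_of_mem _ _ hx]
  let V : ℝ → ℝ := fun x => 1 + ∫ t in (0:ℝ)..x, w t
  have hV : ∀ x, HasDerivAt V (w x) x := fun x =>
    (integral_hasDerivAt_right (hw.intervalIntegrable _ _)
      hw.aestronglyMeasurable.stronglyMeasurableAtFilter hw.continuousAt).const_add 1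
  have hVc : Continuous V := continuous_iff_continuousAt.2 fun x => (hV x).continuousAt
  let u : ℝ → ℝ := fun x => ∫ t in (0:ℝ)..x, V t
  have hu : ∀ x, HasDerivAt u (V x) x := fun x =>
    (integral_hasDerivAt_right (hVc.intervalIntegrable _ _)
      hVc.aestronglyMeasurable.stronglyMeasurableAtFilter hVc.continuousAt)
  have huc : Continuous u := continuous_iff_continuousAt.2 fun x => (hu x).continuousAt
  have hdu : deriv u = V := funext fun x => (hu x).deriv
  have hdV : deriv V = w := funext fun x => (hV x).deriv
  have hd1 : ∀ x ∈ Icc (0:ℝ) 1, V x = (α x).2 := by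
    apply eq_of_has_deriv_right_eq (f' := w)
    · exact fun x _ => (hV x).hasDerivWithinAt
    · intro x hx
      have := (hα' x hx).snd
      rw [hf x ⟨hx.1, hx.2.le⟩] at this
      rw [hwα x ⟨hx.1, hx.2.le⟩]
      exact this
    · exact hVc.continuousOn
    · exact continuous_snd.comp_continuousOn hαc
    · simp [V, h0]
  have hd0 : ∀ x ∈ Icc (0:ℝ) 1, u x = (α x).1 := by
    apply eq_of_has_deriv_right_eq (f' := V)
    · exact fun x _ => (hu x).hasDerivWithinAt
    · intro x hx
      have := (hα' x hx).fst
      rw [hf x ⟨hx.1, hx.2.le⟩] at this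
      rw [hd1 x ⟨hx.1, hx.2.le⟩]
      exact this
    · exact huc.continuousOn
    · exact continuous_fst.comp_continuousOn hαc
    · simp [u, h0]
  refine ⟨u, ⟨?_, ?_⟩, ?_, ?_⟩
  · have : ContDiff ℝ (1 + 1) u := by
      refine contDiff_succ_iff_deriv.2 ⟨fun x => (hu x).differentiableAt, by simp, ?_⟩
      rw [hdu, contDiff_one_iff_deriv, hdV]
      exact ⟨fun x => (hV x).differentiableAt, hw⟩
    convert this using 1
    norm_num
  · intro x hx
    rw [hdu, hdV, hwα x hx, hd0 x hx]
  · simp [u]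
  · rw [hdu]; simp [V]

lemma sol_cont {q : ℝ → ℝ} (hq : Continuous q) {U : ℝ → ℝ → ℝ}
    (hU : ∀ l, Sol (fun x => q x - l) (U l)) (hU0 : ∀ l, U l 0 = 0)
    (hU1 : ∀ l, deriv (U l) 0 = 1) : Continuous fun l => U l 1 := by
  obtain ⟨M, hM, hb⟩ := exists_bd hq
  rw [continuous_iff_continuousAt]
  intro l0
  obtain ⟨B, hB, hBb⟩ := exists_bd (hU l0).1.continuous
  have key : ∀ l, |l - l0| ≤ 1 →
      |U l 1 - U l0 1| ≤ gronwallBound 0 (M + |l0| + 1) (|l - l0| * B) (1 - 0) := by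
    intro l hl
    have hK : 1 ≤ M + |l0| + 1 := by linarith [abs_nonneg l0]
    have h := norm_le_gronwallBound_of_norm_deriv_right_le (δ := 0) (K := M + |l0| + 1)
      (ε := |l - l0| * B) (a := 0) (b := 1)
      (f := fun x => ((U l x - U l0 x, deriv (U l) x - deriv (U l0) x) : ℝ × ℝ))
      (f' := fun x => (deriv (U l) x - deriv (U l0) x,
        deriv (deriv (U l)) x - deriv (deriv (U l0)) x))
      (by
        have a1 := (hU l).1.continuous
        have a2 := (hU l0).1.continuous
        have a3 := (c2_deriv_c1 (hU l).1).continuous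
        have a4 := (c2_deriv_c1 (hU l0).1).continuous
        exact Continuous.continuousOn (by fun_prop))
      (fun x _ => (((c2_deriv (hU l).1 x).sub (c2_deriv (hU l0).1 x)).prodMk
        ((c2_deriv2 (hU l).1 x).sub (c2_deriv2 (hU l0).1 x))).hasDerivWithinAt)
      (by simp [hU0, hU1])
      (by
        intro x hx
        have hx' : x ∈ Icc (0:ℝ) 1 := ⟨hx.1, hx.2.le⟩
        rw [(hU l).2 x hx', (hU l0).2 x hx']
        have e : ((deriv (U l) x - deriv (U l0) x,
            (q x - l) * U l x - (q x - l0) * U l0 x) : ℝ × ℝ) =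
            (deriv (U l) x - deriv (U l0) x, (q x - l) * (U l x - U l0 x)) +
              (0, (l0 - l) * U l0 x) := by
          ext
          · simp
          · simp; ring
        rw [e]
        refine (norm_add_le _ _).trans (add_le_add ?_ ?_)
        · apply field_norm_le hK
          have h1 : |q x - l| ≤ |q x| + |l| := abs_sub _ _
          have h2 : |l| ≤ |l - l0| + |l0| := by
            simpa using abs_add_le (l - l0) l0
          linarith [hb x hx']
        · refine norm_prod_le_iff.2 ⟨?_, ?_⟩
          · rw [norm_zero]; positivity
          · show |(l0 - l) * U l0 x| ≤ _
            rw [abs_mul, abs_sub_comm]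
            exact mul_le_mul_of_nonneg_left (hBb x hx') (abs_nonneg _)) 1 (by simp)
    exact (norm_fst_le ((U l 1 - U l0 1, deriv (U l) 1 - deriv (U l0) 1) : ℝ × ℝ)).trans h
  have hlim : Filter.Tendsto
      (fun l => gronwallBound 0 (M + |l0| + 1) (|l - l0| * B) (1 - 0)) (nhds l0) (nhds 0) := by
    have hc : Continuous fun l => gronwallBound 0 (M + |l0| + 1) (|l - l0| * B) (1 - 0) :=
      (gronwallBound_continuous_ε 0 (M + |l0| + 1) (1 - 0)).comp
        (by fun_prop : Continuous fun l : ℝ => |l - l0| * B)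
    have := hc.tendsto l0
    simpa [gronwallBound_ε0_δ0] using this
  rw [ContinuousAt, tendsto_iff_dist_tendsto_zero]
  refine squeeze_zero' (Filter.Eventually.of_forall fun _ => dist_nonneg) ?_ hlim
  filter_upwards [Metric.closedBall_mem_nhds l0 one_pos] with l hl
  exact key l (by simpa [Real.dist_eq] using hl)

/-- constant sign on an open interval -/
lemma sign_const {v : ℝ → ℝ} (hv : Continuous v) {a b : ℝ} (h : ∀ x ∈ Ioo a b, v x ≠ 0) :
    (∀ x ∈ Ioo a b, 0 < v x) ∨ (∀ x ∈ Ioo a b, v x < 0) := by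
  by_contra hcon
  push Not at hcon
  obtain ⟨⟨x, hx, hx0⟩, ⟨y, hy, hy0⟩⟩ := hcon
  have h0 : (0:ℝ) ∈ Icc (v x) (v y) := ⟨hx0, hy0⟩
  obtain ⟨z, hz, hz0⟩ := isPreconnected_Ioo.intermediate_value hx hy hv.continuousOn h0
  exact h z hz hz0

lemma deriv_nonneg_left {v : ℝ → ℝ} {a b d : ℝ} (hab : a < b) (h : HasDerivAt v d a)
    (ha : v a = 0) (hp : ∀ x ∈ Ioo a b, 0 ≤ v x) : 0 ≤ d := by
  have h1 := (hasDerivAt_iff_tendsto_slope.1 h).mono_left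
    (nhdsWithin_mono a (fun x (hx : x ∈ Ioi a) => (mem_Ioi.1 hx).ne'))
  refine ge_of_tendsto h1 ?_
  filter_upwards [Ioo_mem_nhdsGT hab] with x hx
  rw [slope_def_field, ha, sub_zero]
  exact div_nonneg (hp x hx) (by linarith [hx.1])

lemma deriv_nonpos_right {v : ℝ → ℝ} {a b d : ℝ} (hab : a < b) (h : HasDerivAt v d b)
    (hb : v b = 0) (hp : ∀ x ∈ Ioo a b, 0 ≤ v x) : d ≤ 0 := by
  have h1 := (hasDerivAt_iff_tendsto_slope.1 h).mono_left
    (nhdsWithin_mono b (fun x (hx : x ∈ Iio b) => (mem_Iio.1 hx).ne))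
  refine le_of_tendsto h1 ?_
  filter_upwards [Ioo_mem_nhdsLT hab] with x hx
  rw [slope_def_field, hb, sub_zero]
  exact div_nonpos_of_nonneg_of_nonpos (hp x hx) (by linarith [hx.2])

/-- positivity right of a zero with positive derivative -/
lemma pos_right {v : ℝ → ℝ} {a b d : ℝ} (hab : a < b) (h : HasDerivAt v d a)
    (ha : v a = 0) (hd : 0 < d) : ∃ x ∈ Ioo a b, 0 < v x := by
  by_contra hcon
  push Not at hcon
  have := deriv_nonneg_left (v := fun x => -v x) hab h.neg (by simp [ha])
    (fun x hx => by linarith [hcon x hx])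
  linarith

lemma sturm_pos {q v v1 g h : ℝ → ℝ} {l a b : ℝ} (hab : a < b) (hl : l ≤ 0)
    (hv : ∀ x ∈ Icc a b, HasDerivAt v (v1 x) x)
    (hv1 : ∀ x ∈ Icc a b, HasDerivAt v1 ((q x - l) * v x) x)
    (hg : ∀ x ∈ Icc a b, HasDerivAt g (h x) x)
    (hh : ∀ x ∈ Icc a b, HasDerivAt h (q x * g x) x)
    (ha : v a = 0) (hb : v b = 0) (ha1 : v1 a ≠ 0) (hb1 : v1 b ≠ 0)
    (hvp : ∀ x ∈ Ioo a b, 0 < v x) (hgp : ∀ x ∈ Ioo a b, 0 < g x) : g a = 0 ∧ g b = 0 := by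
  have hva : 0 ≤ v1 a := deriv_nonneg_left hab (hv a (left_mem_Icc.2 hab.le)) ha
    fun x hx => (hvp x hx).le
  have hvb : v1 b ≤ 0 := deriv_nonpos_right hab (hv b (right_mem_Icc.2 hab.le)) hb
    fun x hx => (hvp x hx).le
  have hgc : ContinuousOn g (Icc a b) := fun x hx => (hg x hx).continuousAt.continuousWithinAt
  have hgI : ∀ x ∈ Icc a b, 0 ≤ g x := by
    have h1 : Icc a b ⊆ closure (Ioo a b) := by rw [closure_Ioo hab.ne]
    intro x hx
    have := (hgc x hx).mono (Ioo_subset_Icc_self)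
    have hx' := h1 hx
    have : g x ∈ closure (Ici (0:ℝ)) :=
      this.mem_closure hx' (fun y hy => (hgp y hy).le)
    simpa using this
  have hga := hgI a (left_mem_Icc.2 hab.le)
  have hgb := hgI b (right_mem_Icc.2 hab.le)
  have hW : ∀ x ∈ Icc a b, HasDerivAt (fun x => v1 x * g x - v x * h x) (-l * (v x * g x)) x := by
    intro x hx
    have := ((hv1 x hx).mul (hg x hx)).sub ((hv x hx).mul (hh x hx))
    exact this.congr_deriv (by ring)
  obtain ⟨c, hc, hce⟩ := exists_hasDerivAt_eq_slope (fun x => v1 x * g x - v x * h x)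
    (fun x => -l * (v x * g x)) hab
    (fun x hx => (hW x hx).continuousAt.continuousWithinAt)
    (fun x hx => hW x (Ioo_subset_Icc_self hx))
  have hpos : 0 ≤ -l * (v c * g c) := by
    have := mul_pos (hvp c hc) (hgp c hc)
    nlinarith
  rw [hce] at hpos
  have h2 : 0 ≤ v1 b * g b - v1 a * g a := by
    have := mul_nonneg hpos (sub_pos.2 hab).le
    rw [div_mul_cancel₀ _ (sub_pos.2 hab).ne'] at this
    simpa [ha, hb] using this
  have h3 : 0 ≤ v1 a * g a := mul_nonneg hva hga
  have h4 : v1 b * g b ≤ 0 := mul_nonpos_of_nonpos_of_nonneg hvb hgb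
  constructor
  · have : v1 a * g a = 0 := by linarith
    exact (mul_eq_zero.1 this).resolve_left ha1
  · have : v1 b * g b = 0 := by linarith
    exact (mul_eq_zero.1 this).resolve_left hb1

lemma sturm_ne {q v v1 g h : ℝ → ℝ} {l a b : ℝ} (hab : a < b) (hl : l ≤ 0)
    (hvc : Continuous v) (hgc : Continuous g)
    (hv : ∀ x ∈ Icc a b, HasDerivAt v (v1 x) x)
    (hv1 : ∀ x ∈ Icc a b, HasDerivAt v1 ((q x - l) * v x) x)
    (hg : ∀ x ∈ Icc a b, HasDerivAt g (h x) x)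
    (hh : ∀ x ∈ Icc a b, HasDerivAt h (q x * g x) x)
    (ha : v a = 0) (hb : v b = 0) (ha1 : v1 a ≠ 0) (hb1 : v1 b ≠ 0)
    (hvp : ∀ x ∈ Ioo a b, v x ≠ 0) (hgp : ∀ x ∈ Ioo a b, g x ≠ 0) : g a = 0 ∧ g b = 0 := by
  have hnv : ∀ x ∈ Icc a b, HasDerivAt (fun x => -v x) (-v1 x) x := fun x hx => (hv x hx).neg
  have hnv1 : ∀ x ∈ Icc a b, HasDerivAt (fun x => -v1 x) ((q x - l) * (-v x)) x := fun x hx => by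
    have := (hv1 x hx).neg
    rw [mul_neg]; exact this
  have hng : ∀ x ∈ Icc a b, HasDerivAt (fun x => -g x) (-h x) x := fun x hx => (hg x hx).neg
  have hnh : ∀ x ∈ Icc a b, HasDerivAt (fun x => -h x) (q x * (-g x)) x := fun x hx => by
    have := (hh x hx).neg
    rw [mul_neg]; exact this
  rcases sign_const hvc hvp with sv | sv <;> rcases sign_const hgc hgp with sg | sg
  · exact sturm_pos hab hl hv hv1 hg hh ha hb ha1 hb1 sv sg
  · have := sturm_pos hab hl hv hv1 hng hnh ha hb ha1 hb1 sv (fun x hx => by linarith [sg x hx])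
    simpa using this
  · exact sturm_pos hab hl hnv hnv1 hg hh (by simp [ha]) (by simp [hb]) (by simpa using ha1)
      (by simpa using hb1) (fun x hx => by linarith [sv x hx]) sg
  · have := sturm_pos hab hl hnv hnv1 hng hnh (by simp [ha]) (by simp [hb]) (by simpa using ha1)
      (by simpa using hb1) (fun x hx => by linarith [sv x hx]) (fun x hx => by linarith [sg x hx])
    simpa using this

/-- consecutive zeros around a nonzero point -/
lemma consec {v : ℝ → ℝ} (hv : Continuous v) {a b c : ℝ} (hac : a ≤ c) (hcb : c ≤ b)
    (ha : v a = 0) (hb : v b = 0) (hc : v c ≠ 0) :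
    ∃ a' b', a ≤ a' ∧ a' < b' ∧ b' ≤ b ∧ v a' = 0 ∧ v b' = 0 ∧ ∀ x ∈ Ioo a' b', v x ≠ 0 := by
  have hcl : IsClosed {x | v x = 0} := isClosed_eq hv continuous_const
  obtain ⟨a', ha', hmax⟩ := ((isCompact_Icc (a := a) (b := c)).inter_right hcl).exists_isGreatest
    ⟨a, ⟨le_rfl, hac⟩, ha⟩
  obtain ⟨b', hb', hmin⟩ := ((isCompact_Icc (a := c) (b := b)).inter_right hcl).exists_isLeast
    ⟨b, ⟨hcb, le_rfl⟩, hb⟩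
  have h1 : a' < c := lt_of_le_of_ne ha'.1.2 (fun h => hc (h ▸ ha'.2))
  have h2 : c < b' := lt_of_le_of_ne hb'.1.1 (fun h => hc (h ▸ hb'.2))
  refine ⟨a', b', ha'.1.1, h1.trans h2, hb'.1.2, ha'.2, hb'.2, ?_⟩
  intro x hx h0
  rcases le_total x c with h | h
  · exact absurd (hmax ⟨⟨ha'.1.1.trans hx.1.le, h⟩, h0⟩) (not_le.2 hx.1)
  · exact absurd (hmin ⟨⟨h, hx.2.le.trans hb'.1.2⟩, h0⟩) (not_le.2 hx.2)

lemma phi_sol {μ : ℝ} {φ : ℝ → ℝ} (hφreg : ContDiff ℝ 2 φ)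
    (hφode : ∀ x ∈ Set.Ioo (0:ℝ) 1, -(deriv (deriv φ) x) + μ * φ x - (φ x)^3 = 0) :
    Sol (fun x => μ - φ x ^ 2) φ := by
  refine ⟨hφreg, ext_Icc (c2_cont2 hφreg) ?_ ?_⟩
  · have := hφreg.continuous
    fun_prop
  · intro x hx
    linear_combination -(hφode x hx)

lemma phi_d0 {μ : ℝ} {φ : ℝ → ℝ} (hs : Sol (fun x => μ - φ x ^ 2) φ) (hφ0 : φ 0 = 0)
    (hφpos : ∀ x ∈ Set.Ioo (0:ℝ) 1, 0 < φ x) : deriv φ 0 ≠ 0 := by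
  intro h
  have hc := hs.1.continuous
  have := sol_uniq (by fun_prop) hs (t := 0) (by simp) hφ0 h (1/2) (by norm_num)
  linarith [hφpos (1/2) (by norm_num)]

lemma phi_energy {μ : ℝ} {φ : ℝ → ℝ} (hs : Sol (fun x => μ - φ x ^ 2) φ) (hφ0 : φ 0 = 0) :
    ∀ x ∈ Icc (0:ℝ) 1, 2 * deriv φ x ^ 2 - 2 * μ * φ x ^ 2 + φ x ^ 4 = 2 * deriv φ 0 ^ 2 := by
  have hc := hs.1.continuous
  have hc1 := (c2_deriv_c1 hs.1).continuous
  have := constant_of_has_deriv_right_zero (a := 0) (b := 1)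
    (f := fun x => 2 * deriv φ x ^ 2 - 2 * μ * φ x ^ 2 + φ x ^ 4)
    (Continuous.continuousOn (by fun_prop)) (by
      intro x hx
      have h1 := c2_deriv hs.1 x
      have h2 := c2_deriv2 hs.1 x
      rw [hs.2 x ⟨hx.1, hx.2.le⟩] at h2
      have := (((h2.pow 2).const_mul 2).sub ((h1.pow 2).const_mul (2 * μ))).add (h1.pow 4)
      refine (this.congr_deriv ?_).hasDerivWithinAt
      simp only [Nat.cast_ofNat]
      ring)
  intro x hx
  have h := this x hx
  simp only [hφ0] at h
  rw [h]; ring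

lemma phi_crit {μ : ℝ} (hμ : 0 < μ) {φ : ℝ → ℝ} (hs : Sol (fun x => μ - φ x ^ 2) φ)
    (hφ0 : φ 0 = 0) (hφ1 : φ 1 = 0) (hφpos : ∀ x ∈ Set.Ioo (0:ℝ) 1, 0 < φ x)
    {a b : ℝ} (ha : 0 ≤ a) (hab : a < b) (hb : b ≤ 1) (ha' : deriv φ a = 0)
    (hb' : deriv φ b = 0) : False := by
  have hc := hs.1.continuous
  have hd0 := phi_d0 hs hφ0 hφpos
  have hE := phi_energy hs hφ0
  have he : 0 < 2 * deriv φ 0 ^ 2 := by positivity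
  have hnn : ∀ x ∈ Icc (0:ℝ) 1, 0 ≤ φ x := by
    intro x hx
    rcases eq_or_lt_of_le hx.1 with h | h
    · rw [← h, hφ0]
    · rcases eq_or_lt_of_le hx.2 with h' | h'
      · rw [h', hφ1]
      · exact (hφpos x ⟨h, h'⟩).le
  have hsub : Icc a b ⊆ Icc (0:ℝ) 1 := Icc_subset_Icc ha hb
  have lev : ∀ x ∈ Icc a b, deriv φ x = 0 → 2 * μ < φ x ^ 2 := by
    intro x hx h
    have h1 := hE x (hsub hx)
    rw [h] at h1
    by_contra hcon
    push Not at hcon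
    nlinarith [sq_nonneg (φ x)]
  obtain ⟨m, hm, hmin⟩ := (isCompact_Icc (a := a) (b := b)).exists_isMinOn
    (nonempty_Icc.2 hab.le) hc.continuousOn
  have hm' : deriv φ m = 0 := by
    by_cases h1 : m = a
    · rw [h1, ha']
    by_cases h2 : m = b
    · rw [h2, hb']
    have hmI : m ∈ Ioo a b := ⟨lt_of_le_of_ne hm.1 (Ne.symm h1), lt_of_le_of_ne hm.2 h2⟩
    exact (hmin.isLocalMin (Icc_mem_nhds hmI.1 hmI.2)).deriv_eq_zero
  obtain ⟨c, hcI, hc0⟩ := exists_hasDerivAt_eq_zero hab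
    (c2_deriv_c1 hs.1).continuous.continuousOn (ha'.trans hb'.symm)
    (fun x _ => c2_deriv2 hs.1 x)
  have hcc := Ioo_subset_Icc_self hcI
  rw [hs.2 c (hsub hcc)] at hc0
  have hcpos : 0 < φ c := hφpos c ⟨ha.trans_lt hcI.1, hcI.2.trans_le hb⟩
  have h3 : μ - φ c ^ 2 = 0 := (mul_eq_zero.1 hc0).resolve_right hcpos.ne'
  have h4 := lev m hm hm'
  have h5 : φ m ≤ φ c := hmin hcc
  have h6 := hnn m (hsub hm)
  nlinarith

/-- A nontrivial solution of `v'' = (q - l) v`, `l ≤ 0`, `v 0 = 0`, has at most one zero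
in `(0,1]`. -/
lemma no_two_zeros {μ : ℝ} (hμ : 0 < μ) {φ : ℝ → ℝ} (hs : Sol (fun x => μ - φ x ^ 2) φ)
    (hφ0 : φ 0 = 0) (hφ1 : φ 1 = 0) (hφpos : ∀ x ∈ Set.Ioo (0:ℝ) 1, 0 < φ x)
    {l : ℝ} (hl : l ≤ 0) {v : ℝ → ℝ} (hv : Sol (fun x => (μ - 3 * φ x ^ 2) - l) v)
    {z z2 : ℝ} (hz0 : 0 < z) (hz2 : z < z2) (hz1 : z2 ≤ 1) (h0 : v 0 = 0) (h1 : v z = 0)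
    (h2 : v z2 = 0) : ∀ x ∈ Icc (0:ℝ) 1, v x = 0 := by
  by_contra hcon
  have hc := hs.1.continuous
  have hvc := hv.1.continuous
  have hgc := (c2_deriv_c1 hs.1).continuous
  have hp : Continuous (fun x => (μ - 3 * φ x ^ 2) - l) := by fun_prop
  have nz : ∀ t ∈ Icc (0:ℝ) 1, v t = 0 → deriv v t ≠ 0 := fun t ht ht0 ht1 =>
    hcon (sol_uniq hp hv ht ht0 ht1)
  -- on every `[a,b]` with `v a = v b = 0` the function `φ'` vanishes inside
  have key : ∀ a b : ℝ, 0 ≤ a → a < b → b ≤ 1 → v a = 0 → v b = 0 →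
      ∃ x ∈ Ioo a b, deriv φ x = 0 := by
    intro a b ha hab hb hva hvb
    by_contra hno
    push Not at hno
    have hex : ∃ c ∈ Ioo a b, v c ≠ 0 := by
      obtain ⟨c, hcI, hc0⟩ := exists_hasDerivAt_eq_zero hab hvc.continuousOn
        (hva.trans hvb.symm) (fun x _ => c2_deriv hv.1 x)
      exact ⟨c, hcI, fun h => nz c ⟨ha.trans hcI.1.le, hcI.2.le.trans hb⟩ h hc0⟩
    obtain ⟨c, hcI, hc0⟩ := hex
    obtain ⟨a', b', haa, hab', hbb, ha0, hb0, hne⟩ := consec hvc hcI.1.le hcI.2.le hva hvb hc0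
    have hsub : Icc a' b' ⊆ Icc (0:ℝ) 1 := Icc_subset_Icc (ha.trans haa) (hbb.trans hb)
    have := sturm_ne (q := fun x => μ - 3 * φ x ^ 2) (v := v) (v1 := deriv v) (g := deriv φ)
      (h := fun x => (μ - φ x ^ 2) * φ x) hab' hl hvc hgc
      (fun x _ => c2_deriv hv.1 x)
      (fun x hx => by
        have := c2_deriv2 hv.1 x
        rw [hv.2 x (hsub hx)] at this
        exact this)
      (fun x hx => by
        have := c2_deriv2 hs.1 x
        rw [hs.2 x (hsub hx)] at this
        exact this)
      (fun x hx => by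
        have h1 := c2_deriv hs.1 x
        have := ((h1.pow 2).const_sub μ).mul h1
        refine this.congr_deriv ?_
        simp only [Nat.cast_ofNat, Pi.pow_apply]
        ring)
      ha0 hb0 (nz a' (hsub (left_mem_Icc.2 hab'.le)) ha0)
      (nz b' (hsub (right_mem_Icc.2 hab'.le)) hb0) hne
      (fun x hx => hno x ⟨haa.trans_lt hx.1, hx.2.trans_le hbb⟩)
    exact phi_crit hμ hs hφ0 hφ1 hφpos (ha.trans haa) hab' (hbb.trans hb) this.1 this.2
  obtain ⟨x, hx, hx0⟩ := key 0 z le_rfl hz0 (hz2.le.trans hz1) h0 h1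
  obtain ⟨y, hy, hy0⟩ := key z z2 hz0.le hz2 hz1 h1 h2
  exact phi_crit hμ hs hφ0 hφ1 hφpos hx.1.le (hx.2.trans hy.1) (hy.2.le.trans hz1) hx0 hy0

/-- Wronskian with `φ`. -/
lemma phi_wronsk {μ : ℝ} {φ : ℝ → ℝ} (hs : Sol (fun x => μ - φ x ^ 2) φ)
    (hφ0 : φ 0 = 0) (hφ1 : φ 1 = 0) (hφpos : ∀ x ∈ Set.Ioo (0:ℝ) 1, 0 < φ x)
    {v : ℝ → ℝ} (hv : Sol (fun x => μ - 3 * φ x ^ 2) v) (h0 : v 0 = 0) (h1 : 0 ≤ v 1)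
    (hpos : ∀ x ∈ Ioo (0:ℝ) 1, 0 < v x) : False := by
  have hd1 : deriv φ 1 ≤ 0 := deriv_nonpos_right one_pos (c2_deriv hs.1 1) hφ1
    (fun x hx => (hφpos x hx).le)
  have hW : ∀ x ∈ Icc (0:ℝ) 1, HasDerivAt (fun x => deriv v x * φ x - v x * deriv φ x)
      (-2 * φ x ^ 3 * v x) x := by
    intro x hx
    have a1 := c2_deriv2 hv.1 x
    have a2 := c2_deriv2 hs.1 x
    rw [hv.2 x hx] at a1
    rw [hs.2 x hx] at a2
    have := (a1.mul (c2_deriv hs.1 x)).sub ((c2_deriv hv.1 x).mul a2)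
    exact this.congr_deriv (by ring)
  obtain ⟨c, hc, hce⟩ := exists_hasDerivAt_eq_slope (fun x => deriv v x * φ x - v x * deriv φ x)
    (fun x => -2 * φ x ^ 3 * v x) one_pos
    (fun x hx => (hW x hx).continuousAt.continuousWithinAt)
    (fun x hx => hW x (Ioo_subset_Icc_self hx))
  simp only [hφ0, hφ1, h0] at hce
  have h3 := hpos c hc
  have h4 := hφpos c hc
  have h5 : 0 < φ c ^ 3 * v c := by positivity
  nlinarith

lemma sol_neg {p v : ℝ → ℝ} (hv : Sol p v) : Sol p (fun x => -v x) := by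
  refine ⟨hv.1.neg, fun x hx => ?_⟩
  have e : deriv (fun x => -v x) = fun x => -deriv v x := by
    funext y; exact (c2_deriv hv.1 y).neg.deriv
  have e2 : deriv (fun x => -deriv v x) x = -deriv (deriv v) x :=
    (c2_deriv2 hv.1 x).neg.deriv
  rw [e, e2, hv.2 x hx]; ring

lemma kernel_trivial {μ : ℝ} (hμ : 0 < μ) {φ : ℝ → ℝ} (hs : Sol (fun x => μ - φ x ^ 2) φ)
    (hφ0 : φ 0 = 0) (hφ1 : φ 1 = 0) (hφpos : ∀ x ∈ Set.Ioo (0:ℝ) 1, 0 < φ x)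
    {v : ℝ → ℝ} (hv : Sol (fun x => μ - 3 * φ x ^ 2) v) (h0 : v 0 = 0) (h1 : v 1 = 0) :
    ∀ x ∈ Icc (0:ℝ) 1, v x = 0 := by
  by_contra hcon
  have hv' : Sol (fun x => (μ - 3 * φ x ^ 2) - 0) v := by simpa using hv
  have hne : ∀ x ∈ Ioo (0:ℝ) 1, v x ≠ 0 := fun x hx hx0 =>
    hcon (no_two_zeros hμ hs hφ0 hφ1 hφpos le_rfl hv' hx.1 hx.2 le_rfl h0 hx0 h1)
  rcases sign_const hv.1.continuous hne with h | h
  · exact phi_wronsk hs hφ0 hφ1 hφpos hv h0 h1.ge h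
  · exact phi_wronsk hs hφ0 hφ1 hφpos (sol_neg hv) (by simp [h0]) (by simp [h1])
      (fun x hx => by linarith [h x hx])

lemma eig_unique {μ : ℝ} (hμ : 0 < μ) {φ : ℝ → ℝ} (hs : Sol (fun x => μ - φ x ^ 2) φ)
    (hφ0 : φ 0 = 0) (hφ1 : φ 1 = 0) (hφpos : ∀ x ∈ Set.Ioo (0:ℝ) 1, 0 < φ x)
    {l k : ℝ} (hl : l ≤ 0) (hk : k ≤ 0) {v w : ℝ → ℝ}
    (hv : Sol (fun x => (μ - 3 * φ x ^ 2) - l) v) (hw : Sol (fun x => (μ - 3 * φ x ^ 2) - k) w)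
    (hv0 : v 0 = 0) (hv1 : v 1 = 0) (hw0 : w 0 = 0) (hw1 : w 1 = 0)
    (hvn : ¬ ∀ x ∈ Icc (0:ℝ) 1, v x = 0) (hwn : ¬ ∀ x ∈ Icc (0:ℝ) 1, w x = 0) : l = k := by
  have hvne : ∀ x ∈ Ioo (0:ℝ) 1, v x ≠ 0 := fun x hx hx0 =>
    hvn (no_two_zeros hμ hs hφ0 hφ1 hφpos hl hv hx.1 hx.2 le_rfl hv0 hx0 hv1)
  have hwne : ∀ x ∈ Ioo (0:ℝ) 1, w x ≠ 0 := fun x hx hx0 =>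
    hwn (no_two_zeros hμ hs hφ0 hφ1 hφpos hk hw hx.1 hx.2 le_rfl hw0 hx0 hw1)
  have hW : ∀ x ∈ Icc (0:ℝ) 1, HasDerivAt (fun x => deriv v x * w x - v x * deriv w x)
      ((k - l) * (v x * w x)) x := by
    intro x hx
    have a1 := c2_deriv2 hv.1 x
    have a2 := c2_deriv2 hw.1 x
    rw [hv.2 x hx] at a1
    rw [hw.2 x hx] at a2
    have := (a1.mul (c2_deriv hw.1 x)).sub ((c2_deriv hv.1 x).mul a2)
    exact this.congr_deriv (by ring)
  obtain ⟨c, hc, hce⟩ := exists_hasDerivAt_eq_zero one_pos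
    (fun x hx => (hW x hx).continuousAt.continuousWithinAt)
    (by simp [hv0, hv1, hw0, hw1])
    (fun x hx => hW x (Ioo_subset_Icc_self hx))
  have := (mul_eq_zero.1 hce).resolve_right (mul_ne_zero (hvne c hc) (hwne c hc))
  linarith

lemma nontriv {u : ℝ → ℝ} (hu : ContDiff ℝ 2 u) (h0 : u 0 = 0) (h1 : deriv u 0 = 1) :
    ∃ x ∈ Ioo (0:ℝ) 1, 0 < u x :=
  pos_right one_pos (c2_deriv hu 0) h0 (by rw [h1]; exact one_pos)

/-- no zeros in `(x,1]` and `0 < u x` gives `0 < u 1`. -/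
lemma pos_at {u : ℝ → ℝ} (hu : Continuous u) {x y : ℝ} (hxy : x ≤ y) (hx : 0 < u x)
    (h : ∀ z ∈ Icc x y, u z ≠ 0) : 0 < u y := by
  by_contra hcon
  push Not at hcon
  obtain ⟨z, hz, hz0⟩ := intermediate_value_Icc' hxy hu.continuousOn
    (⟨hcon, hx.le⟩ : (0:ℝ) ∈ Icc (u y) (u x))
  exact h z hz hz0

lemma shoot_pos {p u : ℝ → ℝ} (hp : Continuous p) (hp1 : ∀ x ∈ Icc (0:ℝ) 1, 1 ≤ p x)
    (hu : Sol p u) (h0 : u 0 = 0) (h1 : deriv u 0 = 1) : 0 < u 1 := by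
  obtain ⟨x, hx, hxp⟩ := nontriv hu.1 h0 h1
  refine pos_at hu.1.continuous hx.2.le hxp ?_
  intro z hz hz0
  have hz0' : 0 < z := hx.1.trans_le hz.1
  have hW : ∀ x ∈ Icc (0:ℝ) z, HasDerivAt (fun x => u x * deriv u x)
      (deriv u x ^ 2 + p x * u x ^ 2) x := by
    intro x hx
    have a1 := c2_deriv2 hu.1 x
    rw [hu.2 x ⟨hx.1, hx.2.trans hz.2⟩] at a1
    exact ((c2_deriv hu.1 x).mul a1).congr_deriv (by ring)
  obtain ⟨c, hc, hce⟩ := exists_hasDerivAt_eq_zero hz0'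
    (fun x hx => (hW x hx).continuousAt.continuousWithinAt)
    (by simp [h0, hz0])
    (fun x hx => hW x (Ioo_subset_Icc_self hx))
  have hcI : c ∈ Icc (0:ℝ) 1 := ⟨hc.1.le, hc.2.le.trans hz.2⟩
  have hpc := hp1 c hcI
  have e1 : deriv u c ^ 2 = 0 := by nlinarith [sq_nonneg (u c), sq_nonneg (deriv u c)]
  have e2 : u c ^ 2 = 0 := by nlinarith [sq_nonneg (u c), sq_nonneg (deriv u c)]
  have := sol_uniq hp hu hcI (pow_eq_zero_iff (by norm_num) |>.1 e2)
    (pow_eq_zero_iff (by norm_num) |>.1 e1) x (Ioo_subset_Icc_self hx)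
  linarith

lemma shoot_neg {μ : ℝ} (hμ : 0 < μ) {φ : ℝ → ℝ} (hs : Sol (fun x => μ - φ x ^ 2) φ)
    (hφ0 : φ 0 = 0) (hφ1 : φ 1 = 0) (hφpos : ∀ x ∈ Set.Ioo (0:ℝ) 1, 0 < φ x)
    {u : ℝ → ℝ} (hu : Sol (fun x => μ - 3 * φ x ^ 2) u) (h0 : u 0 = 0) (h1 : deriv u 0 = 1) :
    u 1 < 0 := by
  have hc := hs.1.continuous
  have huc := hu.1.continuous
  have hp : Continuous (fun x => μ - 3 * φ x ^ 2) := by fun_prop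
  obtain ⟨x, hx, hxp⟩ := nontriv hu.1 h0 h1
  have hnt : ¬ ∀ x ∈ Icc (0:ℝ) 1, u x = 0 := fun h => by
    linarith [h x (Ioo_subset_Icc_self hx)]
  have hu' : Sol (fun x => (μ - 3 * φ x ^ 2) - 0) u := by simpa using hu
  by_contra hcon
  push Not at hcon
  have hone : 0 < u 1 := lt_of_le_of_ne hcon fun h =>
    hnt (kernel_trivial hμ hs hφ0 hφ1 hφpos hu h0 h.symm)
  have hz : ∃ z ∈ Ioo (0:ℝ) 1, u z = 0 := by
    by_contra hno
    push Not at hno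
    rcases sign_const huc hno with h | h
    · exact phi_wronsk hs hφ0 hφ1 hφpos hu h0 hcon h
    · linarith [h x hx]
  obtain ⟨z, hz, hz0⟩ := hz
  have hleft : ∀ y ∈ Ioo 0 z, 0 < u y := by
    have hne : ∀ y ∈ Ioo 0 z, u y ≠ 0 := fun y hy hy0 =>
      hnt (no_two_zeros hμ hs hφ0 hφ1 hφpos le_rfl hu' hy.1 hy.2 hz.2.le h0 hy0 hz0)
    rcases sign_const huc hne with h | h
    · exact h
    · obtain ⟨t, ht, htp⟩ := pos_right hz.1 (c2_deriv hu.1 0) h0 (by rw [h1]; exact one_pos)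
      linarith [h t ht]
  have hright : ∀ y ∈ Ioo z 1, 0 < u y := by
    intro y hy
    by_contra hyn
    push Not at hyn
    obtain ⟨t, ht, ht0⟩ := intermediate_value_Icc hy.2.le huc.continuousOn
      (⟨hyn, hone.le⟩ : (0:ℝ) ∈ Icc (u y) (u 1))
    exact hnt (no_two_zeros hμ hs hφ0 hφ1 hφpos le_rfl hu' hz.1 (hy.1.trans_le ht.1) ht.2
      h0 hz0 ht0)
  have d1 := deriv_nonpos_right hz.1 (c2_deriv hu.1 z) hz0 (fun y hy => (hleft y hy).le)
  have d2 := deriv_nonneg_left hz.2 (c2_deriv hu.1 z) hz0 (fun y hy => (hright y hy).le)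
  exact hnt (sol_uniq hp hu (Ioo_subset_Icc_self hz) hz0 (le_antisymm d1 d2))

lemma dom_sol {μ : ℝ} {φ : ℝ → ℝ} (hc : Continuous φ) {l : ℝ} {v : ℝ → ℝ} (hv : Dom2 v)
    (h : ∀ x ∈ Set.Ioo (0:ℝ) 1, Lplus μ φ v x = l * v x) :
    Sol (fun x => (μ - 3 * φ x ^ 2) - l) v := by
  have hvc := hv.1.continuous
  refine ⟨hv.1, ext_Icc (c2_cont2 hv.1) (by fun_prop) fun x hx => ?_⟩
  have := h x hx
  unfold Lplus at this
  linear_combination -this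

lemma int_nontriv {v : ℝ → ℝ} (h : (∫ x in (0:ℝ)..1, (v x)^2) ≠ 0) :
    ¬ ∀ x ∈ Icc (0:ℝ) 1, v x = 0 := by
  intro h0
  apply h
  rw [intervalIntegral.integral_congr (g := fun _ => (0:ℝ))]
  · simp
  · intro x hx
    rw [uIcc_of_le zero_le_one] at hx
    simp [h0 x hx]

/-- L₊ has exactly one negative eigenvalue, all other eigenvalues are strictly
positive, and ker L₊ = {0}. -/
theorem Lplus_spectrum (μ : ℝ) (hμ : 0 < μ) (φ : ℝ → ℝ)
    (hφreg : ContDiff ℝ 2 φ) (hφ0 : φ 0 = 0) (hφ1 : φ 1 = 0)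
    (hφpos : ∀ x ∈ Set.Ioo (0:ℝ) 1, 0 < φ x)
    (hφode : ∀ x ∈ Set.Ioo (0:ℝ) 1,
      -(deriv (deriv φ) x) + μ * φ x - (φ x)^3 = 0) :
    -- exactly one negative eigenvalue
    (∃! lam : ℝ, lam < 0 ∧ IsEigenvalue μ φ lam) ∧
    -- every eigenvalue is either the negative one or strictly positive
    (∀ lam : ℝ, IsEigenvalue μ φ lam → lam < 0 ∨ 0 < lam) ∧
    -- ker L₊ = {0}
    (∀ v : ℝ → ℝ, Dom2 v → (∀ x ∈ Set.Ioo (0:ℝ) 1, Lplus μ φ v x = 0) →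
      ∀ x ∈ Set.Icc (0:ℝ) 1, v x = 0) := by
  have hs := phi_sol hφreg hφode
  have hc := hφreg.continuous
  have hq : Continuous (fun x => μ - 3 * φ x ^ 2) := by fun_prop
  have hker : ∀ v : ℝ → ℝ, Dom2 v → (∀ x ∈ Set.Ioo (0:ℝ) 1, Lplus μ φ v x = 0) →
      ∀ x ∈ Set.Icc (0:ℝ) 1, v x = 0 := by
    intro v hv h
    have := dom_sol (l := 0) hc hv (by simpa using h)
    exact kernel_trivial hμ hs hφ0 hφ1 hφpos (by simpa using this) hv.2.1 hv.2.2
  refine ⟨?_, ?_, hker⟩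
  · have hex : ∃ lam : ℝ, lam < 0 ∧ IsEigenvalue μ φ lam := by
      have hsol : ∀ l : ℝ, ∃ u : ℝ → ℝ, Sol (fun x => (μ - 3 * φ x ^ 2) - l) u ∧ u 0 = 0 ∧
          deriv u 0 = 1 := fun l => exists_sol (hq.sub continuous_const)
      choose U hU hU0 hU1 using hsol
      have hcont := sol_cont hq hU hU0 hU1
      obtain ⟨M, hM, hb⟩ := exists_bd hq
      have hp : 0 < U (-(M + 1)) 1 := by
        refine shoot_pos (hq.sub continuous_const) (fun x hx => ?_) (hU _) (hU0 _) (hU1 _)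
        have := (abs_le.1 (hb x hx)).1
        show 1 ≤ (μ - 3 * φ x ^ 2) - (-(M + 1))
        linarith
      have hn : U 0 1 < 0 :=
        shoot_neg hμ hs hφ0 hφ1 hφpos (by simpa using hU 0) (hU0 0) (hU1 0)
      obtain ⟨l, hl, hl0⟩ := intermediate_value_Icc' (by linarith : -(M + 1) ≤ 0)
        hcont.continuousOn (⟨hn.le, hp.le⟩ : (0:ℝ) ∈ Icc (U 0 1) (U (-(M + 1)) 1))
      have hl0' : U l 1 = 0 := hl0
      refine ⟨l, lt_of_le_of_ne hl.2 (fun h => ?_), U l, ⟨(hU l).1, hU0 l, hl0'⟩, ?_, ?_⟩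
      · rw [h] at hl0'
        linarith
      · obtain ⟨x, hx, hxp⟩ := nontriv (hU l).1 (hU0 l) (hU1 l)
        have hcU := (hU l).1.continuous
        refine (intervalIntegral.integral_pos one_pos (Continuous.continuousOn (by fun_prop))
          (fun y _ => sq_nonneg _) ⟨x, Ioo_subset_Icc_self hx, by positivity⟩).ne'
      · intro x hx
        unfold Lplus
        rw [(hU l).2 x (Ioo_subset_Icc_self hx)]
        ring
    obtain ⟨l, hl, hle⟩ := hex
    refine ⟨l, ⟨hl, hle⟩, ?_⟩
    rintro k ⟨hk, hke⟩
    obtain ⟨v, hv, hvi, hveq⟩ := hle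
    obtain ⟨w, hw, hwi, hweq⟩ := hke
    exact eig_unique hμ hs hφ0 hφ1 hφpos hk.le hl.le (dom_sol hc hw hweq) (dom_sol hc hv hveq)
      hw.2.1 hw.2.2 hv.2.1 hv.2.2 (int_nontriv hwi) (int_nontriv hvi)
  · intro l hl
    rcases lt_trichotomy l 0 with h | h | h
    · exact Or.inl h
    · exfalso
      obtain ⟨v, hv, hvi, hveq⟩ := hl
      exact int_nontriv hvi (hker v hv (fun x hx => by rw [hveq x hx, h, zero_mul]))
    · exact Or.inr h
end
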